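/- arXiv:1802.09449 — 4 statements merged into one kernel-verified Lean document; each statement's English description precedes it below -/
import Mathlib

section
/- Let G be a group and let A ⊆ G be a maximal coclique. If the subgroup ⟨A⟩ generated by A is a proper subgroup of G, then the underlying set of ⟨A⟩ equals A, and ⟨A⟩ is a maximal subgroup of G. -/
/-- A subset `A` of a group `G` is a *coclique* if any two of its elements
generate a proper subgroup of `G`. -/
def IsCoclique {G : Type*} [Group G] (A : Set G) : Prop :=
  ∀ g ∈ A, ∀ h ∈ A, Subgroup.closure {g, h} ≠ ⊤

/-- A coclique is *maximal* if the only coclique containing it is itself. -/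
def IsMaximalCoclique {G : Type*} [Group G] (A : Set G) : Prop :=
  IsCoclique A ∧ ∀ B : Set G, IsCoclique B → A ⊆ B → A = B

theorem Subgroup.isCoclique_of_ne_top {G : Type*} [Group G] {H : Subgroup G} (hH : H ≠ ⊤) :
    IsCoclique (H : Set G) := fun _ hg _ hh htop =>
  hH <| top_le_iff.mp <| htop.symm.trans_le <|
    (Subgroup.closure_le H).mpr <| Set.pair_subset hg hh

theorem maximal_coclique_closure_ne_top {G : Type*} [Group G] (A : Set G)
    (hA : IsMaximalCoclique A) (h : Subgroup.closure A ≠ ⊤) :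
    (Subgroup.closure A : Set G) = A ∧ IsCoatom (Subgroup.closure A) := by
  refine ⟨(hA.2 _ (Subgroup.isCoclique_of_ne_top h) Subgroup.subset_closure).symm, h, ?_⟩
  intro K hK
  by_contra hne
  have hAK : A = K :=
    hA.2 _ (Subgroup.isCoclique_of_ne_top hne) (Subgroup.subset_closure.trans hK.le)
  exact hK.ne (by rw [hAK, Subgroup.closure_eq])
end

section
/- Let G be a finite group and let g ∈ G lie in a unique maximal subgroup M of G; that is, M is a maximal subgroup of G with g ∈ M, and every maximal subgroup of G containing g is equal to M. Then every maximal coclique A of G with g ∈ A is equal to the underlying set of M. -/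
theorem maximal_coclique_of_unique_maximal_subgroup {G : Type*} [Group G] [Finite G]
    (g : G) (M : Subgroup G) (hM : IsCoatom M) (hgM : g ∈ M)
    (huniq : ∀ N : Subgroup G, IsCoatom N → g ∈ N → N = M)
    (A : Set G) (hA : IsMaximalCoclique A) (hgA : g ∈ A) :
    A = (M : Set G) := by
  refine hA.2 M ?_ ?_
  · intro x hx y hy htop
    refine hM.1 (top_le_iff.mp (htop ▸ ?_))
    exact (Subgroup.closure_le M).mpr (Set.pair_subset hx hy)
  · intro h hh
    obtain ⟨N, hN, hle⟩ :=
      (eq_top_or_exists_le_coatom (Subgroup.closure {g, h})).resolve_left (hA.1 g hgA h hh)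
    have hgN : g ∈ N := hle (Subgroup.subset_closure (Set.mem_insert g {h}))
    have hhN : h ∈ N := hle (Subgroup.subset_closure (Set.mem_insert_of_mem g rfl))
    exact huniq N hN hgN ▸ hhN
end

section
/- Let p > 2 be a prime, G = PSL₂(p), and let A ⊆ G be a maximal coclique which is not the underlying set of a maximal subgroup of G. Suppose A contains an element x of order greater than 2 such that every element of A not lying in the cyclic subgroup ⟨x⟩ has order 2. If the order of x divides p + 1 and G contains A₄ as a maximal subgroup, then |A| ≤ (3/2)(p + 1) + 4, i.e. 2·|A| ≤ 3(p + 1) + 8. -/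
open scoped MatrixGroups

/-- `G` contains a maximal subgroup isomorphic to `H`. -/
def HasMaximalSubgroupIsoTo (G : Type*) [Group G] (H : Type*) [Group H] : Prop :=
  ∃ M : Subgroup G, IsCoatom M ∧ Nonempty (M ≃* H)

section SpecialLinear

variable {F : Type*} [Field F]

lemma SL2.mem_center_iff {g : SL(2, F)} :
    g ∈ Subgroup.center SL(2, F) ↔ g = 1 ∨ g = -1 := by
  rw [Matrix.SpecialLinearGroup.mem_center_iff]
  constructor
  · rintro ⟨r, hr, h⟩
    have hr' : r = 1 ∨ r = -1 := by simpa using hr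
    rcases hr' with rfl | rfl
    · left; ext i j; rw [← h]; simp
    · right; ext i j; rw [← h]; fin_cases i <;> fin_cases j <;> simp
  · rintro (rfl | rfl)
    · exact ⟨1, by simp, by simp⟩
    · exact ⟨-1, by simp, by ext i j; fin_cases i <;> fin_cases j <;> simp⟩

lemma PSL2.mk_eq_mk_iff {g h : SL(2, F)} :
    (g : PSL(2, F)) = (h : PSL(2, F)) ↔ g = h ∨ g = -h := by
  rw [QuotientGroup.eq, SL2.mem_center_iff, inv_mul_eq_one, inv_mul_eq_iff_eq_mul]
  refine or_congr Iff.rfl ?_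
  rw [mul_neg, mul_one]
  constructor
  · rintro rfl; simp
  · rintro rfl; simp

lemma PSL2.mk_eq_one_iff {g : SL(2, F)} : (g : PSL(2, F)) = 1 ↔ g = 1 ∨ g = -1 :=
  PSL2.mk_eq_mk_iff (h := 1)

lemma SL2.det_eq (g : SL(2, F)) : g.1 0 0 * g.1 1 1 - g.1 0 1 * g.1 1 0 = 1 := by
  rw [← Matrix.det_fin_two, g.2]

/-- An element of `SL₂` without eigenvectors is not upper triangular. -/
lemma SL2.coeff_ne_zero_of_not_isSquare {g : SL(2, F)} (hg : ¬ IsSquare (g.1.trace ^ 2 - 4)) :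
    g.1 1 0 ≠ 0 := by
  intro h
  refine hg ⟨g.1 0 0 - g.1 1 1, ?_⟩
  rw [Matrix.trace_fin_two]
  linear_combination 4 * SL2.det_eq g + 4 * g.1 0 1 * h

lemma SL2.sq_eq (g : SL(2, F)) : g.1 ^ 2 = g.1.trace • g.1 - 1 := by
  have := SL2.det_eq g
  ext i j
  fin_cases i <;> fin_cases j <;>
    simp [sq, Matrix.mul_apply, Matrix.trace_fin_two] <;> grind

lemma SL2.pow_three_eq (g : SL(2, F)) :
    g.1 ^ 3 = (g.1.trace ^ 2 - 1) • g.1 - g.1.trace • 1 := by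
  rw [pow_succ, SL2.sq_eq, sub_mul, smul_mul_assoc, ← sq, SL2.sq_eq, one_mul]
  module

lemma SL2.pow_four_eq (g : SL(2, F)) :
    g.1 ^ 4 = (g.1.trace * (g.1.trace ^ 2 - 2)) • g.1 - (g.1.trace ^ 2 - 1) • 1 := by
  rw [pow_succ, SL2.pow_three_eq, sub_mul, smul_mul_assoc, ← sq, SL2.sq_eq, smul_mul_assoc,
    one_mul]
  module

lemma SL2.pow_five_eq (g : SL(2, F)) :
    g.1 ^ 5 = (g.1.trace ^ 4 - 3 * g.1.trace ^ 2 + 1) • g.1 -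
      (g.1.trace * (g.1.trace ^ 2 - 2)) • 1 := by
  rw [pow_succ, SL2.pow_four_eq, sub_mul, smul_mul_assoc, ← sq, SL2.sq_eq, smul_mul_assoc,
    one_mul]
  module

/-- If a combination of `g` and the identity is scalar and `g` is not central, the coefficient of
`g` vanishes. -/
lemma SL2.coeff_eq_zero {g : SL(2, F)} (hg : (g : PSL(2, F)) ≠ 1) {r s u : F}
    (h : r • g.1 - s • 1 = u • (1 : Matrix (Fin 2) (Fin 2) F)) : r = 0 := by
  by_contra hr
  apply hg
  rw [QuotientGroup.eq_one_iff, Matrix.SpecialLinearGroup.mem_center_iff]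
  have h' : g.1 = (r⁻¹ * (u + s)) • 1 := by
    rw [mul_smul, add_smul, ← h, sub_add_cancel, inv_smul_smul₀ hr]
  refine ⟨r⁻¹ * (u + s), ?_, ?_⟩
  · have := g.2
    rw [h'] at this
    simpa using this
  · rw [h', Matrix.scalar_apply, Matrix.smul_one_eq_diagonal]

lemma PSL2.exists_scalar_of_pow_eq_one {g : SL(2, F)} {n : ℕ} (h : (g : PSL(2, F)) ^ n = 1) :
    ∃ u : F, g.1 ^ n = u • 1 := by
  rw [← QuotientGroup.mk_pow, PSL2.mk_eq_one_iff] at h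
  rw [← Matrix.SpecialLinearGroup.coe_pow]
  rcases h with h | h
  · exact ⟨1, by simp [h]⟩
  · exact ⟨-1, by simp [h]⟩

lemma PSL2.trace_eq_zero_of_sq {g : SL(2, F)} (hg : (g : PSL(2, F)) ≠ 1)
    (h : (g : PSL(2, F)) ^ 2 = 1) : g.1.trace = 0 := by
  obtain ⟨u, hu⟩ := PSL2.exists_scalar_of_pow_eq_one h
  rw [SL2.sq_eq] at hu
  exact SL2.coeff_eq_zero hg (s := 1) (u := u) (by rw [← hu, one_smul])

lemma PSL2.trace_sq_of_cube {g : SL(2, F)} (hg : (g : PSL(2, F)) ≠ 1)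
    (h : (g : PSL(2, F)) ^ 3 = 1) : g.1.trace ^ 2 = 1 := by
  obtain ⟨u, hu⟩ := PSL2.exists_scalar_of_pow_eq_one h
  rw [SL2.pow_three_eq] at hu
  exact sub_eq_zero.mp (SL2.coeff_eq_zero hg hu)

lemma SL2.sq_eq_neg_one {g : SL(2, F)} (h : g.1.trace = 0) : g ^ 2 = -1 := by
  ext1 i j
  rw [Matrix.SpecialLinearGroup.coe_pow, SL2.sq_eq, h]
  simp

lemma PSL2.trace_sq_of_order_four {g : SL(2, F)} (h : orderOf (g : PSL(2, F)) = 4) :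
    g.1.trace ^ 2 = 2 := by
  have hg : (g : PSL(2, F)) ≠ 1 := by rintro hg; simp [hg] at h
  obtain ⟨u, hu⟩ := PSL2.exists_scalar_of_pow_eq_one (h ▸ pow_orderOf_eq_one (g : PSL(2, F)))
  rw [SL2.pow_four_eq] at hu
  rcases mul_eq_zero.mp (SL2.coeff_eq_zero hg hu) with h0 | h0
  · have h2 : (g : PSL(2, F)) ^ 2 = 1 := by
      rw [← QuotientGroup.mk_pow, SL2.sq_eq_neg_one h0, PSL2.mk_eq_one_iff]
      exact Or.inr rfl
    have := orderOf_le_of_pow_eq_one two_pos h2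
    omega
  · exact sub_eq_zero.mp h0

lemma PSL2.trace_of_order_five {g : SL(2, F)} (h : orderOf (g : PSL(2, F)) = 5) :
    (2 * g.1.trace ^ 2 - 3) ^ 2 = 5 := by
  have hg : (g : PSL(2, F)) ≠ 1 := by rintro hg; simp [hg] at h
  obtain ⟨u, hu⟩ := PSL2.exists_scalar_of_pow_eq_one (h ▸ pow_orderOf_eq_one (g : PSL(2, F)))
  rw [SL2.pow_five_eq] at hu
  linear_combination 4 * SL2.coeff_eq_zero hg hu

lemma SL2.trace_mul_comm (g h : SL(2, F)) : (g * h).1.trace = (h * g).1.trace := by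
  simp only [Matrix.SpecialLinearGroup.coe_mul]
  exact Matrix.trace_mul_comm _ _

lemma SL2.trace_neg (g : SL(2, F)) : (-g).1.trace = -g.1.trace := by
  simp

lemma SL2.trace_mul_inv_add (g h : SL(2, F)) :
    (g * h⁻¹).1.trace + (g * h).1.trace = g.1.trace * h.1.trace := by
  simp [Matrix.adjugate_fin_two, Matrix.trace_fin_two, Matrix.mul_apply]
  ring

/-- Commuting elements of `SL₂` with a common trace, not that of a parabolic element, are equal or
mutually inverse. -/
lemma SL2.eq_or_eq_inv_of_commute (h2 : (2 : F) ≠ 0) {g h : SL(2, F)} (hc : g * h = h * g)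
    (ht : g.1.trace = h.1.trace) (h4 : g.1.trace ^ 2 ≠ 4) (h10 : g.1 1 0 ≠ 0) :
    h = g ∨ h = g⁻¹ := by
  have hg := SL2.det_eq g
  have hh := SL2.det_eq h
  have e00 := congrArg (fun m : SL(2, F) => m.1 0 0) hc
  have e10 := congrArg (fun m : SL(2, F) => m.1 1 0) hc
  simp only [Matrix.SpecialLinearGroup.coe_mul, Matrix.mul_apply, Fin.sum_univ_two] at e00 e10
  rw [Matrix.trace_fin_two] at h4
  rw [Matrix.trace_fin_two, Matrix.trace_fin_two] at ht
  generalize ha : g.1 0 0 = a at *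
  generalize hb : g.1 0 1 = b at *
  generalize hc : g.1 1 0 = c at *
  generalize hd : g.1 1 1 = d at *
  generalize ha' : h.1 0 0 = a' at *
  generalize hb' : h.1 0 1 = b' at *
  generalize hc' : h.1 1 0 = c' at *
  generalize hd' : h.1 1 1 = d' at *
  obtain ⟨k, rfl⟩ : ∃ k, c' = k * c := ⟨c' / c, by field_simp⟩
  have hb'' : b' = k * b := mul_right_cancel₀ h10 (by linear_combination -e00)
  have hdiff : a' - d' = k * (a - d) := mul_right_cancel₀ h10 (by linear_combination e10)
  have hk : (k - 1) * (k + 1) = 0 := by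
    refine (mul_eq_zero.mp ?_).resolve_right (sub_ne_zero.mpr h4)
    subst hb''
    have e1 : (a' + d') ^ 2 = (a + d) ^ 2 := by rw [ht]
    have e2 : (a' - d') ^ 2 = (k * (a - d)) ^ 2 := by rw [hdiff]
    linear_combination e1 - e2 - 4 * hh + 4 * k ^ 2 * hg
  rcases mul_eq_zero.mp hk with hk | hk
  · left
    have hk : k = 1 := sub_eq_zero.mp hk
    subst hk hb''
    ext i j
    fin_cases i <;> fin_cases j <;> simp [ha, hb, hc, hd, ha', hb', hc', hd']
    · exact mul_left_cancel₀ h2 (by linear_combination hdiff - ht)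
    · exact mul_left_cancel₀ h2 (by linear_combination -hdiff - ht)
  · right
    have hk : k = -1 := eq_neg_of_add_eq_zero_left hk
    subst hk hb''
    ext i j
    fin_cases i <;> fin_cases j <;>
      simp [ha, hb, hc, hd, ha', hb', hc', hd', Matrix.SpecialLinearGroup.SL2_inv_expl]
    · exact mul_left_cancel₀ h2 (by linear_combination hdiff - ht)
    · exact mul_left_cancel₀ h2 (by linear_combination -hdiff - ht)

end SpecialLinear

section Projective

open Matrix.SpecialLinearGroup

variable (F K : Type*) [Field F] [Field K] [Algebra F K]

open Classical in
/-- The action of `SL₂(F)` on the projective line over an extension `K` of `F`. -/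
noncomputable def SL2.toPerm : SL(2, F) →* Equiv.Perm (OnePoint K) :=
  (MulAction.toPermHom (GL (Fin 2) K) (OnePoint K)).comp
    (toGL.comp (Matrix.SpecialLinearGroup.map (algebraMap F K)))

variable {F K}

lemma SL2.toPerm_infty_iff (g : SL(2, F)) :
    SL2.toPerm F K g OnePoint.infty = OnePoint.infty ↔ g.1 1 0 = 0 := by
  classical
  rw [SL2.toPerm, MonoidHom.comp_apply, MulAction.toPermHom_apply, MulAction.toPerm_apply]
  convert OnePoint.smul_infty_eq_self_iff (g := _) using 1
  simp

lemma SL2.toPerm_coe_iff (g : SL(2, F)) (k : K) :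
    SL2.toPerm F K g (k : OnePoint K) = k ↔ algebraMap F K (g.1 1 0) * k ^ 2 +
      algebraMap F K (g.1 1 1 - g.1 0 0) * k - algebraMap F K (g.1 0 1) = 0 := by
  classical
  rw [SL2.toPerm, MonoidHom.comp_apply, MulAction.toPermHom_apply, MulAction.toPerm_apply]
  convert (Matrix.GeneralLinearGroup.fixpointPolynomial_aeval_eq_zero_iff (g := _)).symm using 1
  simp [Matrix.GeneralLinearGroup.fixpointPolynomial]

variable (F K) in
/-- The action of `PSL₂(F)` on the projective line over an extension `K` of `F`. -/
noncomputable def PSL2.toPerm : PSL(2, F) →* Equiv.Perm (OnePoint K) :=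
  QuotientGroup.lift _ (SL2.toPerm F K) (by
    intro g hg
    rw [SL2.mem_center_iff] at hg
    ext P
    induction P with
    | infty => rcases hg with rfl | rfl <;> simp [SL2.toPerm_infty_iff]
    | coe k =>
      refine (SL2.toPerm_coe_iff g k).mpr ?_
      rcases hg with rfl | rfl <;> simp)

/-- An element with distinct eigenvalues in `K` has exactly two fixed points on the projective
line. -/
lemma SL2.ncard_fixed_points (h2 : (2 : K) ≠ 0) {g : SL(2, F)} {s : K} (hs : s ≠ 0)
    (hsq : s ^ 2 = algebraMap F K (g.1.trace ^ 2 - 4)) :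
    {P : OnePoint K | SL2.toPerm F K g P = P}.ncard = 2 := by
  have hdet := congrArg (algebraMap F K) (SL2.det_eq g)
  have hinf := SL2.toPerm_infty_iff (K := K) g
  have hcoe := SL2.toPerm_coe_iff (K := K) g
  simp only [Matrix.trace_fin_two, map_sub, map_add, map_mul, map_pow, map_one, map_ofNat] at *
  by_cases hc : g.1 1 0 = 0
  · simp only [hc, map_zero, zero_mul, zero_add, mul_zero, sub_zero, iff_true] at *
    set a := algebraMap F K (g.1 0 0)
    set b := algebraMap F K (g.1 0 1)
    set d := algebraMap F K (g.1 1 1)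
    have hda : d - a ≠ 0 := by
      intro h
      apply hs
      have h0 : s ^ 2 = 0 := by rw [hsq]; linear_combination (d - a) * h + 4 * hdet
      simpa using h0
    have : {P : OnePoint K | SL2.toPerm F K g P = P} =
        {OnePoint.infty, ((b / (d - a) : K) : OnePoint K)} := by
      ext P
      induction P with
      | infty => simp [hinf]
      | coe k =>
        simp only [Set.mem_ofPred_eq, hcoe, Set.mem_insert_iff, OnePoint.coe_ne_infty, false_or,
          Set.mem_singleton_iff, OnePoint.coe_eq_coe, eq_div_iff hda]
        grind
    rw [this, Set.ncard_pair (OnePoint.infty_ne_coe _)]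
  · have hc' : algebraMap F K (g.1 1 0) ≠ 0 := by simpa using hc
    set a := algebraMap F K (g.1 0 0)
    set b := algebraMap F K (g.1 0 1)
    set c := algebraMap F K (g.1 1 0)
    set d := algebraMap F K (g.1 1 1)
    have h2c : 2 * c ≠ 0 := mul_ne_zero h2 hc'
    have : {P : OnePoint K | SL2.toPerm F K g P = P} =
        {(((a - d + s) / (2 * c) : K) : OnePoint K),
          (((a - d - s) / (2 * c) : K) : OnePoint K)} := by
      ext P
      induction P with
      | infty => simp [hinf, hc]
      | coe k =>
        simp only [Set.mem_ofPred_eq, hcoe, Set.mem_insert_iff,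
          Set.mem_singleton_iff, OnePoint.coe_eq_coe, eq_div_iff h2c]
        have key : (k * (2 * c) - (a - d + s)) * (k * (2 * c) - (a - d - s)) =
            4 * c * (c * k ^ 2 + (d - a) * k - b) := by
          linear_combination -hsq - 4 * hdet
        rw [← sub_eq_zero (a := k * (2 * c)), ← sub_eq_zero (a := k * (2 * c)), ← mul_eq_zero, key]
        have h4c : 4 * c ≠ 0 := by
          have : (4 : K) * c = 2 * (2 * c) := by ring
          rw [this]; exact mul_ne_zero h2 h2c
        simp [h4c]
    rw [this, Set.ncard_pair]
    rw [Ne, OnePoint.coe_eq_coe, div_left_inj' h2c]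
    intro h
    have : 2 * s = 0 := by linear_combination h
    exact (mul_ne_zero h2 hs) this

lemma SL2.trace_commutator (g h : SL(2, F)) :
    (g * h * g⁻¹ * h⁻¹).1.trace = 2 - (g.1 * h.1 - h.1 * g.1).det := by
  have hg := SL2.det_eq g
  have hh := SL2.det_eq h
  simp only [Matrix.SpecialLinearGroup.coe_mul, Matrix.SpecialLinearGroup.coe_inv,
    Matrix.adjugate_fin_two, Matrix.trace_fin_two, Matrix.det_fin_two, Matrix.mul_apply,
    Fin.sum_univ_two, Matrix.sub_apply, Matrix.of_apply, Matrix.cons_val', Matrix.cons_val_zero,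
    Matrix.cons_val_one, Matrix.cons_val_fin_one]
  generalize g.1 0 0 = a at *
  generalize g.1 0 1 = b at *
  generalize g.1 1 0 = c at *
  generalize g.1 1 1 = d at *
  generalize h.1 0 0 = a' at *
  generalize h.1 0 1 = b' at *
  generalize h.1 1 0 = c' at *
  generalize h.1 1 1 = d' at *
  linear_combination (2 * (a' * d' - b' * c')) * hg + 2 * hh

/-- The commutator of two elements with a common fixed point is unipotent. -/
lemma SL2.trace_commutator_of_fixed {g h : SL(2, F)} {P : OnePoint K}
    (hg : SL2.toPerm F K g P = P) (hh : SL2.toPerm F K h P = P) :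
    (g * h * g⁻¹ * h⁻¹).1.trace = 2 := by
  rw [SL2.trace_commutator, sub_eq_self]
  simp only [Matrix.det_fin_two, Matrix.mul_apply, Fin.sum_univ_two, Matrix.sub_apply]
  induction P with
  | infty =>
    rw [SL2.toPerm_infty_iff] at hg hh
    rw [hg, hh]
    ring
  | coe k =>
    rw [SL2.toPerm_coe_iff, sub_eq_zero] at hg hh
    apply (algebraMap F K).injective
    simp only [map_sub, map_add, map_mul, map_zero] at *
    rw [← hg, ← hh]
    ring

end Projective

section Char

variable {F : Type*} [Field F] {p : ℕ} [Fact p.Prime] [CharP F p]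

lemma PSL2.pow_char_of_parabolic {g : SL(2, F)} (h : g.1.trace ^ 2 = 4) :
    (g : PSL(2, F)) ^ p = 1 := by
  have h' : (g.1.trace - 2) * (g.1.trace + 2) = 0 := by linear_combination h
  have hp := (Fact.out : p.Prime)
  have key : ∀ g : SL(2, F), g.1.trace = 2 → g ^ p = 1 := by
    intro g hg
    ext1 i j
    rw [Matrix.SpecialLinearGroup.coe_pow, Matrix.SpecialLinearGroup.coe_one]
    have hsq : (g.1 - 1) ^ 2 = 0 := by
      have e : (g.1 - 1) ^ 2 = g.1 ^ 2 - 2 • g.1 + 1 := by noncomm_ring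
      rw [e, SL2.sq_eq, hg]
      module
    have := sub_pow_char_of_commute (p := p) (Commute.one_right g.1)
    rw [← Nat.sub_add_cancel hp.two_le, pow_add, hsq, mul_zero, Nat.sub_add_cancel hp.two_le,
      one_pow] at this
    rw [sub_eq_zero.mp this.symm]
  rcases mul_eq_zero.mp h' with h' | h'
  · rw [← QuotientGroup.mk_pow, key g (sub_eq_zero.mp h')]
    rfl
  · have := key (-g) (by rw [SL2.trace_neg]; linear_combination -h')
    have e : (g : PSL(2, F)) = ((-g : SL(2, F)) : PSL(2, F)) :=
      PSL2.mk_eq_mk_iff.mpr (Or.inr (neg_neg g).symm)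
    rw [e, ← QuotientGroup.mk_pow, this]
    rfl

end Char

section Prime

variable {p : ℕ} [Fact p.Prime]

lemma SL2.pow_sub_one_of_split (h2 : (2 : ZMod p) ≠ 0) {g : SL(2, ZMod p)} {s : ZMod p} (hs : s ≠ 0)
    (hsq : g.1.trace ^ 2 - 4 = s ^ 2) : g ^ (p - 1) = 1 := by
  have hp := (Fact.out : p.Prime)
  obtain ⟨l, hl2⟩ : ∃ l, 2 * l = g.1.trace + s := ⟨(g.1.trace + s) / 2, by field_simp⟩
  have h4 : (4 : ZMod p) ≠ 0 := by
    have : (4 : ZMod p) = 2 * 2 := by norm_num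
    rw [this]; exact mul_ne_zero h2 h2
  have hchar : l ^ 2 = g.1.trace * l - 1 :=
    mul_left_cancel₀ h4 (by linear_combination (2 * l - g.1.trace + s) * hl2 - hsq)
  have hE : ∀ k : ℕ, (g.1 - l • 1) ^ (k + 1) = (-s) ^ k • (g.1 - l • 1) := by
    intro k
    induction k with
    | zero => simp
    | succ k ih =>
      have e : (g.1 - l • (1 : Matrix (Fin 2) (Fin 2) (ZMod p))) * (g.1 - l • 1) =
          (-s) • (g.1 - l • 1) := by
        have e' : (g.1 - l • (1 : Matrix (Fin 2) (Fin 2) (ZMod p))) * (g.1 - l • 1) =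
            g.1 ^ 2 - (2 * l) • g.1 + l ^ 2 • 1 := by
          simp only [sq, sub_mul, mul_sub, smul_mul_assoc, mul_smul_comm, one_mul, mul_one]
          module
        have e1 : (-s) = g.1.trace - 2 * l := by linear_combination hl2
        rw [e', SL2.sq_eq, hchar, e1]
        have e2 : g.1.trace * l - 1 = - ((g.1.trace - 2 * l) * l) + 1 := by
          linear_combination -2 * hchar
        rw [e2]
        module
      rw [pow_succ, ih, smul_mul_assoc, e, smul_smul, ← pow_succ]
  have hEp := hE (p - 1)
  rw [Nat.sub_add_cancel hp.one_le, ZMod.pow_card_sub_one_eq_one (neg_ne_zero.mpr hs), one_smul,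
    sub_pow_char_of_commute (p := p) ((Commute.one_right g.1).smul_right l), smul_pow, one_pow,
    ZMod.pow_card, sub_left_inj] at hEp
  have : g ^ (p - 1 + 1) = g := by
    rw [Nat.sub_add_cancel hp.one_le]
    exact Subtype.ext (by rw [Matrix.SpecialLinearGroup.coe_pow, hEp])
  rwa [pow_succ, mul_eq_right] at this

/-- An element of `PSL₂(p)` whose order is larger than `2` and divides `p + 1` has no eigenvector
over the prime field. -/
lemma PSL2.not_isSquare_of_orderOf_dvd (h2 : (2 : ZMod p) ≠ 0) {g : SL(2, ZMod p)}
    (hg : 2 < orderOf (g : PSL(2, ZMod p))) (hd : orderOf (g : PSL(2, ZMod p)) ∣ p + 1) :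
    ¬ IsSquare (g.1.trace ^ 2 - 4) := by
  have hp := (Fact.out : p.Prime)
  rintro ⟨s, hs⟩
  rw [← sq] at hs
  by_cases h0 : s = 0
  · have := orderOf_dvd_of_pow_eq_one
      (PSL2.pow_char_of_parabolic (p := p) (g := g) (by rw [h0] at hs; linear_combination hs))
    have := (Nat.dvd_add_right this).mp hd
    have := Nat.le_of_dvd one_pos this
    omega
  · have h1 := SL2.pow_sub_one_of_split h2 h0 hs
    have h1' : (g : PSL(2, ZMod p)) ^ (p - 1) = 1 := by
      rw [← QuotientGroup.mk_pow, h1]; rfl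
    have := orderOf_dvd_of_pow_eq_one h1'
    have e : p + 1 = (p - 1) + 2 := by have := hp.one_le; omega
    rw [e] at hd
    have := Nat.le_of_dvd two_pos ((Nat.dvd_add_right this).mp hd)
    omega

end Prime

section Burnside

/-- The solutions of `1/r + 1/s + 1/t = 1 + 2/N`, with one of the denominators equal to `2`. -/
lemma spherical_triple_of_two {N b c s t : ℕ} (hb : b * s = N) (hc : c * t = N)
    (hs : 2 ≤ s) (ht : 2 ≤ t) (hsum : 2 * b + 2 * c = N + 4) :
    (s ≤ 3 ∧ t ≤ 3) ∨ s = 4 ∨ t = 4 ∨ s = 5 ∨ t = 5 ∨ (s = 2 ∧ c = 2) ∨ (t = 2 ∧ b = 2) := by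
  rcases Nat.lt_or_ge s 4 with h | h
  · interval_cases s
    · have : c = 2 := by omega
      simp [this]
    · by_contra! hcon
      have h6 : 6 ≤ t := by omega
      have := Nat.mul_le_mul_left c h6
      omega
  · rcases Nat.lt_or_ge t 4 with h' | h'
    · interval_cases t
      · have : b = 2 := by omega
        simp [this]
      · by_contra! hcon
        have h6 : 6 ≤ s := by omega
        have := Nat.mul_le_mul_left b h6
        omega
    · have := Nat.mul_le_mul_left c h'
      have := Nat.mul_le_mul_left b h
      omega

/-- The solutions of `1/r + 1/s + 1/t = 1 + 2/N`. -/
lemma spherical_triple {N a b c r s t : ℕ} (ha : a * r = N) (hb : b * s = N) (hc : c * t = N)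
    (hr : 2 ≤ r) (hs : 2 ≤ s) (ht : 2 ≤ t) (hsum : a + b + c = N + 2) :
    (r ≤ 3 ∧ s ≤ 3 ∧ t ≤ 3) ∨ (r = 4 ∨ s = 4 ∨ t = 4) ∨ (r = 5 ∨ s = 5 ∨ t = 5) ∨
      (r = 2 ∧ s = 2 ∧ c = 2) ∨ (r = 2 ∧ t = 2 ∧ b = 2) ∨ (s = 2 ∧ t = 2 ∧ a = 2) := by
  by_cases h2 : r = 2
  · have := spherical_triple_of_two hb hc hs ht (by subst h2; omega)
    omega
  by_cases h3 : s = 2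
  · have := spherical_triple_of_two ha hc hr ht (by subst h3; omega)
    omega
  by_cases h4 : t = 2
  · have := spherical_triple_of_two ha hb hr hs (by subst h4; omega)
    omega
  have := Nat.mul_le_mul_left a (show 3 ≤ r by omega)
  have := Nat.mul_le_mul_left b (show 3 ≤ s by omega)
  have := Nat.mul_le_mul_left c (show 3 ≤ t by omega)
  omega

open MulAction

/-- The structure of the stabilizers of a finite group acting in such a way that each nontrivial
element has exactly two fixed points. -/
theorem MulAction.stabilizer_cases_of_two_fixed_points {H Ω : Type*} [Group H] [Finite H]
    [Finite Ω] [MulAction H Ω] (hfix : ∀ g : H, g ≠ 1 → (fixedBy Ω g).ncard = 2) :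
    (∃ P : Ω, ∀ g : H, g • P = P) ∨
    (∀ P Q : Ω, 2 < Nat.card (stabilizer H P) → 2 < Nat.card (stabilizer H Q) →
      Q ∈ orbit H P ∧ (orbit H P).ncard = 2) ∨
    (∀ P : Ω, Nat.card (stabilizer H P) ≤ 3) ∨
    (∃ P : Ω, Nat.card (stabilizer H P) = 4) ∨
    (∃ P : Ω, Nat.card (stabilizer H P) = 5) := by
  classical
  have := Fintype.ofFinite H
  have := Fintype.ofFinite Ω
  set N := Nat.card H with hN
  have hNpos : 0 < N := Nat.card_pos
  let s : Quotient (orbitRel H Ω) → ℕ := fun w => Nat.card (stabilizer H w.out)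
  let c : Quotient (orbitRel H Ω) → ℕ := fun w => (orbit H w.out).ncard
  have hcs : ∀ P : Ω, (orbit H P).ncard * Nat.card (stabilizer H P) = N := by
    intro P
    have := card_orbit_mul_card_stabilizer_eq_card_group H P
    rw [← Nat.card_coe_set_eq, Nat.card_eq_fintype_card, Nat.card_eq_fintype_card, this, hN,
      Nat.card_eq_fintype_card]
  have hcs' : ∀ w, c w * s w = N := fun w => hcs w.out
  have horb : ∀ P : Ω, orbit H (Quotient.mk (orbitRel H Ω) P).out = orbit H P := fun P =>
    orbit_eq_iff.mpr (Quotient.mk_out (s := orbitRel H Ω) P)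
  have hc : ∀ P : Ω, (orbit H P).ncard = c (Quotient.mk _ P) := fun P => by
    simp only [c, horb]
  have hs : ∀ P : Ω, Nat.card (stabilizer H P) = s (Quotient.mk _ P) := by
    intro P
    have h1 := hcs P
    rw [hc, ← hcs' (Quotient.mk _ P)] at h1
    refine Nat.eq_of_mul_eq_mul_left ?_ h1
    exact Nat.pos_of_mul_pos_right (hcs' _ ▸ hNpos)
  have hspos : ∀ w, 0 < s w := fun w => Nat.card_pos
  have hcpos : ∀ w, 0 < c w := fun w => Nat.pos_of_mul_pos_right (hcs' w ▸ hNpos)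
  have hΩ : ∑ w, c w = Fintype.card Ω := by
    rw [card_eq_sum_card_group_div_card_stabilizer H Ω]
    refine Finset.sum_congr rfl fun w _ => ?_
    rw [← Nat.card_eq_fintype_card (α := H), ← hN, ← Nat.card_eq_fintype_card, ← hcs' w]
    exact (Nat.mul_div_cancel _ (hspos w)).symm
  have hburn := sum_card_fixedBy_eq_card_orbits_mul_card_group H Ω
  have hsum : ∑ g : H, Fintype.card (fixedBy Ω g) + 2 = Fintype.card Ω + 2 * N := by
    rw [← Finset.add_sum_erase _ _ (Finset.mem_univ (1 : H))]
    have h1 : Fintype.card (fixedBy Ω (1 : H)) = Fintype.card Ω := by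
      rw [← Nat.card_eq_fintype_card, Nat.card_coe_set_eq, fixedBy_one_eq_univ,
        Set.ncard_univ, Nat.card_eq_fintype_card]
    have h2 : ∑ g ∈ Finset.univ.erase (1 : H), Fintype.card (fixedBy Ω g) = (N - 1) * 2 := by
      rw [Finset.sum_const_nat (m := 2)]
      · rw [Finset.card_erase_of_mem (Finset.mem_univ _), Finset.card_univ, hN,
          Nat.card_eq_fintype_card]
      · intro g hg
        rw [← hfix g (Finset.ne_of_mem_erase hg), ← Nat.card_eq_fintype_card,
          Nat.card_coe_set_eq]
    rw [h1, h2]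
    omega
  have hcN : ∀ w, c w ≤ N := fun w => Nat.le_of_dvd hNpos ⟨s w, (hcs' w).symm⟩
  have htot : ∑ w, (N - c w) + 2 = 2 * N := by
    have : ∑ w, (N - c w) + ∑ w, c w = Fintype.card (Quotient (orbitRel H Ω)) * N := by
      rw [← Finset.sum_add_distrib, Finset.sum_congr rfl fun w _ => Nat.sub_add_cancel (hcN w)]
      simp
    rw [hburn] at hsum
    rw [hN, Nat.card_eq_fintype_card] at *
    omega
  set W := Finset.univ.filter (fun w => 2 ≤ s w) with hW
  have hnotW : ∀ w, w ∉ W → s w ≤ 1 := by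
    intro w hw
    simp only [hW, Finset.mem_filter_univ] at hw
    omega
  have hWtot : ∑ w ∈ W, (N - c w) + 2 = 2 * N := by
    rw [← htot]
    congr 1
    refine Finset.sum_subset (Finset.subset_univ _) fun w _ hw => ?_
    have h1 : s w = 1 := le_antisymm (hnotW w hw) (hspos w)
    have h2 := hcs' w
    rw [h1] at h2
    omega
  have hWmem : ∀ w ∈ W, 2 ≤ s w := fun w hw => (Finset.mem_filter.mp hw).2
  have hhalf : ∀ w ∈ W, N ≤ 2 * (N - c w) := by
    intro w hw
    have := Nat.mul_le_mul_left (c w) (hWmem w hw)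
    rw [hcs'] at this
    omega
  have hcard : W.card < 4 := by
    have h1 := Finset.card_nsmul_le_sum W _ _ hhalf
    rw [← Finset.mul_sum, smul_eq_mul] at h1
    by_contra! h4
    have := Nat.mul_le_mul_right N h4
    omega
  interval_cases hk : W.card
  · right; right; left
    intro P
    rw [hs]
    rw [Finset.card_eq_zero] at hk
    have := hnotW (Quotient.mk _ P) (by simp [hk])
    omega
  · obtain ⟨a, ha⟩ := Finset.card_eq_one.mp hk
    rw [ha, Finset.sum_singleton] at hWtot
    have hN1 : N = 1 := by have := hcN a; have := hcpos a; omega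
    right; right; left
    intro P
    have := Nat.le_of_dvd hNpos ⟨_, (mul_comm _ _).trans (hcs P) |>.symm⟩
    omega
  · obtain ⟨a, b, hab, ha⟩ := Finset.card_eq_two.mp hk
    rw [ha, Finset.sum_pair hab] at hWtot
    left
    refine ⟨a.out, ?_⟩
    have hca : c a = 1 := by
      have := hcN a; have := hcN b; have := hcpos a; have := hcpos b
      omega
    intro g
    obtain ⟨Q, hQ⟩ := Set.ncard_eq_one.mp hca
    have h1 : g • a.out ∈ orbit H a.out := mem_orbit _ _
    have h2 : a.out ∈ orbit H a.out := mem_orbit_self _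
    rw [hQ, Set.mem_singleton_iff] at h1 h2
    rw [h1]
    exact h2.symm
  · obtain ⟨a, b, d, hab, had, hbd, ha⟩ := Finset.card_eq_three.mp hk
    rw [ha, Finset.sum_insert (by simp [hab, had]), Finset.sum_pair hbd] at hWtot
    have haW : a ∈ W := by simp [ha]
    have hbW : b ∈ W := by simp [ha]
    have hdW : d ∈ W := by simp [ha]
    have hmem : ∀ w, s w ≤ 1 ∨ w = a ∨ w = b ∨ w = d := by
      intro w
      by_cases hw : w ∈ W
      · right; simpa [ha] using hw
      · exact Or.inl (hnotW w hw)
    have hdih : ∀ a' b' d' : Quotient (orbitRel H Ω), (∀ w, s w ≤ 1 ∨ w = a' ∨ w = b' ∨ w = d') →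
        s a' = 2 → s b' = 2 → c d' = 2 →
        ∀ P Q : Ω, 2 < Nat.card (stabilizer H P) → 2 < Nat.card (stabilizer H Q) →
          Q ∈ orbit H P ∧ (orbit H P).ncard = 2 := by
      intro a' b' d' hm ha' hb' hd' P Q hP hQ
      rw [hs] at hP hQ
      have key : ∀ w, 2 < s w → w = d' := by
        intro w hw
        rcases hm w with h | rfl | rfl | h
        · omega
        · omega
        · omega
        · exact h
      have hP' := key _ hP
      have hQ' := key _ hQ
      refine ⟨?_, ?_⟩
      · exact (orbitRel_apply).mp (Quotient.exact (hQ'.trans hP'.symm))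
      · rw [hc, hP', hd']
    have hnum := spherical_triple (hcs' a) (hcs' b) (hcs' d) (hWmem a haW) (hWmem b hbW)
      (hWmem d hdW) (by have := hcN a; have := hcN b; have := hcN d; omega)
    rcases hnum with ⟨h1, h2, h3⟩ | h | h | ⟨h1, h2, h3⟩ | ⟨h1, h2, h3⟩ | ⟨h1, h2, h3⟩
    · right; right; left
      intro P
      rw [hs]
      rcases hmem (Quotient.mk _ P) with h | h | h | h
      · omega
      all_goals rw [h]; assumption
    · right; right; right; left
      rcases h with h | h | h <;> exact ⟨_, h⟩
    · right; right; right; right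
      rcases h with h | h | h <;> exact ⟨_, h⟩
    · right; left
      exact hdih a b d hmem h1 h2 h3
    · right; left
      exact hdih a d b (fun w => by have := hmem w; tauto) h1 h2 h3
    · right; left
      exact hdih b d a (fun w => by have := hmem w; tauto) h1 h2 h3

end Burnside

section Generation

variable {p : ℕ} [Fact p.Prime]

open Matrix Matrix.SpecialLinearGroup

lemma SL2.transvection_mem {H : Subgroup SL(2, ZMod p)} {i j : Fin 2} (hij : i ≠ j) {t : ZMod p}
    (ht : t ≠ 0) (h : SpecialLinearGroup.transvection hij t ∈ H) (c : ZMod p) :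
    SpecialLinearGroup.transvection hij c ∈ H := by
  have hpow : ∀ k : ℕ, SpecialLinearGroup.transvection hij t ^ k =
      SpecialLinearGroup.transvection hij (k * t) := by
    intro k
    induction k with
    | zero => simp [transvection_coeff_zero]
    | succ k ih => rw [pow_succ, ih, ← transvection_add]; congr 1; push_cast; ring
  have := hpow (c / t).val
  rw [ZMod.natCast_zmod_val, div_mul_cancel₀ _ ht] at this
  exact this ▸ pow_mem h _

lemma SL2.eq_top_of_transvections_mem {H : Subgroup SL(2, ZMod p)} {s t : ZMod p}
    (hs : s ≠ 0) (ht : t ≠ 0) (hu : SpecialLinearGroup.transvection (zero_ne_one' (Fin 2)) s ∈ H)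
    (hl : SpecialLinearGroup.transvection (one_ne_zero' (Fin 2)) t ∈ H) : H = ⊤ := by
  refine le_antisymm le_top fun M _ => SL2.transvection_induction (· ∈ H) ?_
    (fun _ _ => mul_mem) M
  intro i j hij c
  fin_cases i
  · obtain rfl : j = 1 := by fin_cases j <;> tauto
    exact SL2.transvection_mem _ hs hu c
  · obtain rfl : j = 0 := by fin_cases j <;> tauto
    exact SL2.transvection_mem _ ht hl c

/-- A nontrivial unipotent element is the identity plus a matrix of rank one. -/
lemma SL2.exists_eq_of_trace_eq_two {F : Type*} [Field F] {U : SL(2, F)} (hU : U ≠ 1)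
    (ht : U.1.trace = 2) : ∃ t a b : F, t ≠ 0 ∧ (a ≠ 0 ∨ b ≠ 0) ∧
      U.1 = !![1 - t * a * b, t * a ^ 2; -(t * b ^ 2), 1 + t * a * b] := by
  have hdet := SL2.det_eq U
  rw [trace_fin_two] at ht
  have h11 : U.1 1 1 = 2 - U.1 0 0 := by linear_combination ht
  rw [h11] at hdet
  by_cases hc : U.1 1 0 = 0
  · have h00 : U.1 0 0 = 1 := by
      have : (U.1 0 0 - 1) ^ 2 = 0 := by rw [hc] at hdet; linear_combination -hdet
      exact sub_eq_zero.mp (by simpa using this)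
    have h11' : U.1 1 1 = 1 := by rw [h11, h00]; ring
    refine ⟨U.1 0 1, 1, 0, ?_, Or.inl one_ne_zero, ?_⟩
    · intro h01
      apply hU
      ext i j
      fin_cases i <;> fin_cases j <;> simp [h00, h01, hc, h11']
    · ext i j
      fin_cases i <;> fin_cases j <;> simp [h00, hc, h11']
  · refine ⟨-U.1 1 0, (U.1 0 0 - 1) / U.1 1 0, 1, neg_ne_zero.mpr hc, Or.inr one_ne_zero, ?_⟩
    ext i j
    fin_cases i <;> fin_cases j <;> simp [h11]
    · field_simp; ring
    · field_simp; linear_combination -hdet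
    · field_simp; ring

/-- A quadratic form with nonsquare discriminant is anisotropic. -/
lemma quadratic_form_ne_zero {F : Type*} [Field F] {a b c u v : F}
    (h : ¬ IsSquare (b ^ 2 - 4 * a * c)) (huv : u ≠ 0 ∨ v ≠ 0) :
    a * u ^ 2 + b * (u * v) + c * v ^ 2 ≠ 0 := by
  intro h0
  apply h
  by_cases hv : v = 0
  · have hu := huv.resolve_right (not_not.mpr hv)
    have : a = 0 := by simpa [hv, hu] using h0
    exact ⟨b, by rw [this]; ring⟩
  · refine ⟨(2 * a * u + b * v) / v, ?_⟩
    field_simp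
    linear_combination -4 * a * h0

/-- A subgroup of `SL₂(p)` containing a nontrivial unipotent element and an element without
eigenvectors is everything. -/
lemma SL2.eq_top_of_unipotent_mem {H : Subgroup SL(2, ZMod p)} {U X : SL(2, ZMod p)}
    (hUH : U ∈ H) (hXH : X ∈ H) (hU : U ≠ 1) (ht : U.1.trace = 2)
    (hX : ¬ IsSquare (X.1.trace ^ 2 - 4)) : H = ⊤ := by
  obtain ⟨t, a, b, ht0, hab, hUe⟩ := SL2.exists_eq_of_trace_eq_two hU ht
  have hXdet := SL2.det_eq X
  rw [trace_fin_two] at hX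
  obtain ⟨q, hq⟩ : ∃ q, q = X.1 1 0 * a ^ 2 + (X.1 1 1 - X.1 0 0) * (a * b) + (-X.1 0 1) * b ^ 2 :=
    ⟨_, rfl⟩
  have hq0 : q ≠ 0 := by
    rw [hq]
    refine quadratic_form_ne_zero ?_ hab
    convert hX using 2
    linear_combination -4 * hXdet
  obtain ⟨P, hP⟩ : ∃ P : SL(2, ZMod p), P.1 =
      !![a, (X.1 0 0 * a + X.1 0 1 * b) / q; b, (X.1 1 0 * a + X.1 1 1 * b) / q] :=
    ⟨⟨_, by rw [det_fin_two_of]; field_simp; rw [hq]; ring⟩, rfl⟩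
  obtain ⟨Q, hQ⟩ : ∃ Q : SL(2, ZMod p), Q.1 =
      !![X.1 1 1 * a - X.1 0 1 * b, a / q; X.1 0 0 * b - X.1 1 0 * a, b / q] :=
    ⟨⟨_, by rw [det_fin_two_of]; field_simp; rw [hq]; ring⟩, rfl⟩
  have hXQ : X * Q = P := by
    refine Subtype.ext ?_
    change X.1 * Q.1 = P.1
    rw [hQ, hP]
    ext i j
    fin_cases i <;> fin_cases j <;> simp [Matrix.mul_apply] <;> field_simp
    · linear_combination a * hXdet
    · linear_combination b * hXdet
  have hu : P * SpecialLinearGroup.transvection (zero_ne_one' (Fin 2)) t * P⁻¹ = U := by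
    rw [mul_inv_eq_iff_eq_mul]
    refine Subtype.ext ?_
    change P.1 * (SpecialLinearGroup.transvection _ _).1 = U.1 * P.1
    rw [hP, hUe, transvection_coe]
    ext i j
    fin_cases i <;> fin_cases j <;>
      simp [Matrix.mul_apply, Matrix.single_apply] <;> field_simp <;> grind
  have hl : P * SpecialLinearGroup.transvection (one_ne_zero' (Fin 2)) (-(t * q ^ 2)) * P⁻¹ =
      X * U * X⁻¹ := by
    rw [mul_inv_eq_iff_eq_mul, ← hXQ]
    simp only [mul_assoc, inv_mul_cancel_left]
    congr 1
    refine Subtype.ext ?_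
    change Q.1 * (SpecialLinearGroup.transvection _ _).1 = U.1 * Q.1
    rw [hQ, hUe, transvection_coe]
    ext i j
    fin_cases i <;> fin_cases j <;>
      simp [Matrix.mul_apply, Matrix.single_apply] <;> field_simp <;> grind
  have hmem := SL2.eq_top_of_transvections_mem (H := H.comap (MulAut.conj P).toMonoidHom) ht0
    (neg_ne_zero.mpr (mul_ne_zero ht0 (pow_ne_zero 2 hq0)))
    (by simpa [hu] using hUH)
    (by simpa [hl] using mul_mem (mul_mem hXH hUH) (inv_mem hXH))
  rw [eq_top_iff]
  intro g _
  have : P⁻¹ * g * P ∈ H.comap (MulAut.conj P).toMonoidHom := hmem ▸ Subgroup.mem_top _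
  simpa [mul_assoc] using this

lemma PSL2.trace_sq_of_pow_char {g : SL(2, ZMod p)} (h : (g : PSL(2, ZMod p)) ^ p = 1) :
    g.1.trace ^ 2 = 4 := by
  rw [← QuotientGroup.mk_pow, PSL2.mk_eq_one_iff] at h
  have hp := ZMod.trace_pow_card g.1
  rw [← Matrix.SpecialLinearGroup.coe_pow, ZMod.pow_card] at hp
  rcases h with h | h <;> rw [← hp, h] <;> norm_num [trace_fin_two]

/-- A subgroup of `PSL₂(p)` of order divisible by `p` and containing an element without
eigenvectors is everything. -/
lemma PSL2.eq_top_of_dvd_card {H : Subgroup PSL(2, ZMod p)} {X : SL(2, ZMod p)}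
    (hXH : (X : PSL(2, ZMod p)) ∈ H) (hX : ¬ IsSquare (X.1.trace ^ 2 - 4))
    (hp : p ∣ Nat.card H) : H = ⊤ := by
  obtain ⟨⟨u, huH⟩, hu⟩ := exists_prime_orderOf_dvd_card' p hp
  rw [Subgroup.orderOf_mk] at hu
  obtain ⟨U, rfl⟩ := QuotientGroup.mk_surjective u
  have hU1 : (U : PSL(2, ZMod p)) ≠ 1 := by
    rintro h
    rw [h, orderOf_one] at hu
    exact (Fact.out : p.Prime).one_lt.ne hu
  have htr := PSL2.trace_sq_of_pow_char (hu ▸ pow_orderOf_eq_one (U : PSL(2, ZMod p)))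
  have htop : H.comap (QuotientGroup.mk' _) = ⊤ := by
    have hU1' : U ≠ 1 ∧ U ≠ -1 := by rwa [Ne, PSL2.mk_eq_one_iff, not_or] at hU1
    have : (U.1.trace - 2) * (U.1.trace + 2) = 0 := by linear_combination htr
    rcases mul_eq_zero.mp this with h | h
    · exact SL2.eq_top_of_unipotent_mem (U := U) (X := X) huH hXH hU1'.1 (sub_eq_zero.mp h) hX
    · have e : (U : PSL(2, ZMod p)) = ((-U : SL(2, ZMod p)) : PSL(2, ZMod p)) :=
        PSL2.mk_eq_mk_iff.mpr (Or.inr (neg_neg U).symm)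
      refine SL2.eq_top_of_unipotent_mem (U := -U) (X := X)
        (by rw [e] at huH; exact huH) hXH ?_ ?_ hX
      · intro h; exact hU1'.2 (by rw [← h, neg_neg])
      · rw [SL2.trace_neg]; linear_combination -h
  rw [← Subgroup.map_comap_eq_self_of_surjective (QuotientGroup.mk'_surjective _) H, htop,
    Subgroup.map_top_of_surjective _ (QuotientGroup.mk'_surjective _)]

end Generation

section Maximal

/-- If the products of elements of a maximal subgroup `M` with powers of `w ∉ M` absorb a
generating set of `M` on the right, then they exhaust the group. -/
lemma card_le_of_isCoatom {G : Type*} [Group G] [Finite G] {M : Subgroup G} (hM : IsCoatom M)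
    {S : Set G} (hS : Subgroup.closure S = M) {w : G} (hw : w ∉ M) {n : ℕ} (hn : 0 < n)
    (hwn : w ^ n = 1)
    (h : ∀ g ∈ S, ∀ j < n, ∃ m ∈ M, ∃ k : ℕ, w ^ j * g = m * w ^ k) :
    Nat.card G ≤ Nat.card M * n := by
  have hmod : ∀ k : ℕ, w ^ k = w ^ (k % n) := fun k => by
    conv_lhs => rw [← Nat.div_add_mod k n, pow_add, pow_mul, hwn, one_pow, one_mul]
  let T : Set G := {g | ∃ m ∈ M, ∃ k : ℕ, g = m * w ^ k}
  let R : Submonoid G :=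
    { carrier := {g | ∀ t ∈ T, t * g ∈ T}
      one_mem' := fun t ht => by rwa [mul_one]
      mul_mem' := fun {a b} ha hb t ht => by
        rw [← mul_assoc]
        exact hb _ (ha _ ht) }
  have hwR : w ∈ R := by
    rintro _ ⟨m, hm, k, rfl⟩
    exact ⟨m, hm, k + 1, by rw [pow_succ, mul_assoc]⟩
  have hSR : S ⊆ R := by
    rintro g hg _ ⟨m, hm, k, rfl⟩
    obtain ⟨m', hm', k', hk⟩ := h g hg (k % n) (Nat.mod_lt _ hn)
    exact ⟨m * m', mul_mem hm hm', k', by rw [mul_assoc, hmod, hk, mul_assoc]⟩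
  have htop : Subgroup.closure (insert w S) = ⊤ := by
    refine hM.2 _ (lt_of_le_of_ne ?_ ?_)
    · rw [← hS]
      exact Subgroup.closure_mono (Set.subset_insert _ _)
    · intro h
      exact hw (h ▸ Subgroup.subset_closure (Set.mem_insert _ _))
  have hT : ∀ g : G, g ∈ T := by
    intro g
    have hg : g ∈ R := by
      have : g ∈ (Subgroup.closure (insert w S)).toSubmonoid := by rw [htop]; trivial
      rw [Subgroup.closure_toSubmonoid_of_finite] at this
      exact Submonoid.closure_le.mpr (Set.insert_subset hwR hSR) this
    have := hg 1 ⟨1, one_mem _, 0, by simp⟩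
    rwa [one_mul] at this
  have hsurj : Function.Surjective (fun x : M × Fin n => (x.1 : G) * w ^ (x.2 : ℕ)) := by
    intro g
    obtain ⟨m, hm, k, rfl⟩ := hT g
    exact ⟨(⟨m, hm⟩, ⟨k % n, Nat.mod_lt _ hn⟩), by rw [hmod k]⟩
  simpa using Nat.card_le_card_of_surjective _ hsurj

set_option maxRecDepth 10000 in
lemma alternatingGroup_four_generators : ∃ a c : alternatingGroup (Fin 4),
    (∀ m, ∃ i j : Fin 2, ∃ k : Fin 3, m = a ^ (i : ℕ) * (c * a * c⁻¹) ^ (j : ℕ) * c ^ (k : ℕ)) ∧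
    a ≠ 1 ∧ a ^ 2 = 1 ∧ c ≠ 1 ∧ c ^ 3 = 1 ∧ a * (c * a * c⁻¹) ≠ 1 ∧
    (a * (c * a * c⁻¹)) ^ 2 = 1 ∧ c * (c * a * c⁻¹) * c⁻¹ = a * (c * a * c⁻¹) := by
  refine ⟨⟨Equiv.swap 0 1 * Equiv.swap 2 3, Equiv.Perm.mem_alternatingGroup.mpr (by decide)⟩,
    ⟨Equiv.swap 1 2 * Equiv.swap 2 3, Equiv.Perm.mem_alternatingGroup.mpr (by decide)⟩, ?_⟩
  refine ⟨?_, by decide, by decide, by decide, by decide, by decide, by decide, by decide⟩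
  decide

set_option maxRecDepth 10000 in
lemma alternatingGroup_four_pow_six : ∀ m : alternatingGroup (Fin 4), m ^ 6 = 1 := by
  decide

lemma exists_generators_of_alternatingGroup_four {G : Type*} [Group G] {M : Subgroup G}
    (e : M ≃* alternatingGroup (Fin 4)) : ∃ a c : G, Subgroup.closure {a, c} = M ∧
    a ≠ 1 ∧ a ^ 2 = 1 ∧ c ≠ 1 ∧ c ^ 3 = 1 ∧ a * (c * a * c⁻¹) ≠ 1 ∧
    (a * (c * a * c⁻¹)) ^ 2 = 1 ∧ c * (c * a * c⁻¹) * c⁻¹ = a * (c * a * c⁻¹) := by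
  obtain ⟨a, c, hgen, h⟩ := alternatingGroup_four_generators
  let f : alternatingGroup (Fin 4) →* G := M.subtype.comp e.symm.toMonoidHom
  have hf : Function.Injective f := M.subtype_injective.comp e.symm.injective
  have hmem : ∀ m, f m ∈ M := fun m => (e.symm m).2
  refine ⟨f a, f c, le_antisymm ?_ ?_, ?_⟩
  · rw [Subgroup.closure_le]
    rintro _ (rfl | rfl) <;> exact hmem _
  · intro m hm
    obtain ⟨i, j, k, hijk⟩ := hgen (e ⟨m, hm⟩)
    have ha : f a ∈ Subgroup.closure {f a, f c} := Subgroup.subset_closure (by simp)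
    have hc : f c ∈ Subgroup.closure {f a, f c} := Subgroup.subset_closure (by simp)
    have : m = f (e ⟨m, hm⟩) := by simp [f]
    rw [this, hijk]
    simp only [map_mul, map_pow, map_inv]
    exact mul_mem (mul_mem (pow_mem ha _) (pow_mem (mul_mem (mul_mem hc ha) (inv_mem hc)) _))
      (pow_mem hc _)
  · simpa only [← map_mul, ← map_inv, ← map_pow, ← map_one f, hf.ne_iff, hf.eq_iff] using h

end Maximal

section Cardinality

/-- The big cell gives `p ^ 2 ≤ |PSL₂(p)|`. -/
lemma PSL2.sq_le_card {p : ℕ} [Fact p.Prime] (h2 : (2 : ZMod p) ≠ 0) :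
    p ^ 2 ≤ Nat.card PSL(2, ZMod p) := by
  let f : ZMod p × ZMod p → SL(2, ZMod p) := fun x =>
    ⟨!![1 + x.1 * x.2, x.1; x.2, 1], by rw [Matrix.det_fin_two_of]; ring⟩
  have hf : Function.Injective (fun x => (f x : PSL(2, ZMod p))) := by
    intro x y h
    rw [PSL2.mk_eq_mk_iff] at h
    rcases h with h | h
    · have e01 := congrArg (fun m : SL(2, ZMod p) => m.1 0 1) h
      have e10 := congrArg (fun m : SL(2, ZMod p) => m.1 1 0) h
      exact Prod.ext e01 e10
    · have e11 : (1 : ZMod p) = -1 := congrArg (fun m : SL(2, ZMod p) => m.1 1 1) h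
      exact absurd (by linear_combination e11) h2
  simpa [sq] using Nat.card_le_card_of_injective _ hf

end Cardinality

section Quaternion

open Quaternion Matrix

variable {F : Type*} [Field F]

lemma Matrix.mul_add_mul_swap_fin_two (x y : Matrix (Fin 2) (Fin 2) F) :
    x * y + y * x = x.trace • y + y.trace • x + ((x * y).trace - x.trace * y.trace) • 1 := by
  ext i j
  fin_cases i <;> fin_cases j <;> simp [Matrix.mul_apply, trace_fin_two] <;> ring

/-- Anticommuting square roots of `-1` in `SL₂` give a representation of the quaternions. -/
lemma SL2.exists_quaternion_hom {x y : SL(2, F)} (hx : x.1.trace = 0)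
    (hy : y.1.trace = 0) (hxy : (x.1 * y.1).trace = 0) :
    ∃ f : ℍ[F] →ₐ[F] Matrix (Fin 2) (Fin 2) F,
      (∀ q : ℍ[F], f q = q.re • 1 + q.imI • x.1 + q.imJ • y.1 + q.imK • (x.1 * y.1)) ∧
      (∀ q : ℍ[F], (f q).det = normSq q) ∧ ∀ q : ℍ[F], (f q).trace = 2 * q.re := by
  have hx2 := SL2.sq_eq x
  have hy2 := SL2.sq_eq y
  have hs := Matrix.mul_add_mul_swap_fin_two x.1 y.1
  rw [hx, zero_smul, zero_sub, sq] at hx2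
  rw [hy, zero_smul, zero_sub, sq] at hy2
  simp only [hx, hy, hxy, zero_smul, zero_mul, sub_zero, add_zero] at hs
  have hyx := eq_neg_of_add_eq_zero_right hs
  let B : QuaternionAlgebra.Basis (Matrix (Fin 2) (Fin 2) F) (-1 : F) 0 (-1) :=
    { i := x.1
      j := y.1
      k := x.1 * y.1
      i_mul_i := by simp [hx2]
      j_mul_j := by simp [hy2]
      i_mul_j := rfl
      j_mul_i := by simp [hyx] }
  obtain ⟨f, hf⟩ : ∃ f : ℍ[F] →ₐ[F] Matrix (Fin 2) (Fin 2) F, ∀ q : ℍ[F],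
      f q = q.re • 1 + q.imI • x.1 + q.imJ • y.1 + q.imK • (x.1 * y.1) := by
    refine ⟨B.liftHom, fun q => ?_⟩
    change algebraMap F _ q.re + q.imI • x.1 + q.imJ • y.1 + q.imK • (x.1 * y.1) = _
    rw [Algebra.algebraMap_eq_smul_one]
  have htr : ∀ q : ℍ[F], (f q).trace = 2 * q.re := by
    intro q
    rw [hf]
    simp [hx, hy, hxy, trace_one]
    ring
  refine ⟨f, hf, fun q => ?_, htr⟩
  have h1 := mul_adjugate (f q)
  have h2 : (f q).adjugate = f (star q) := by
    have : star q = algebraMap F ℍ[F] (2 * q.re) - q := by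
      ext <;> simp; ring
    rw [this, map_sub, AlgHom.commutes, ← htr, Algebra.algebraMap_eq_smul_one]
    generalize f q = m
    ext i j
    fin_cases i <;> fin_cases j <;> simp [adjugate_fin_two, trace_fin_two]
  rw [h2, ← map_mul, Quaternion.self_mul_star] at h1
  have h3 := congrFun (congrFun h1 0) 0
  have h4 : f ((normSq q : F) : ℍ[F]) = algebraMap F _ (normSq q) := AlgHom.commutes _ _
  rw [h4] at h3
  simpa [Algebra.algebraMap_eq_smul_one] using h3.symm

/-- An element of `SL₂` of trace one permuting cyclically `x`, `y` and `x * y`. -/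
lemma SL2.two_smul_eq (h2 : (2 : F) ≠ 0) {x y z : SL(2, F)} (hx : x.1.trace = 0)
    (hy : y.1.trace = 0) (hxy : (x.1 * y.1).trace = 0) (hz : z.1.trace = 1)
    (hzx : z * x = y * z) (hzy : z * y = x * y * z) :
    (2 : F) • z.1 = 1 + x.1 + y.1 + x.1 * y.1 := by
  have hx2 := SL2.sq_eq x
  have hy2 := SL2.sq_eq y
  have hs := Matrix.mul_add_mul_swap_fin_two x.1 y.1
  have h1 := Matrix.mul_add_mul_swap_fin_two z.1 x.1
  have h2' := Matrix.mul_add_mul_swap_fin_two z.1 y.1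
  have h3 := Matrix.mul_add_mul_swap_fin_two z.1 (x.1 * y.1)
  replace hzx : z.1 * x.1 = y.1 * z.1 := congrArg Subtype.val hzx
  replace hzy : z.1 * y.1 = x.1 * y.1 * z.1 := congrArg Subtype.val hzy
  rw [hx, zero_smul, zero_sub, sq] at hx2
  rw [hy, zero_smul, zero_sub, sq] at hy2
  simp only [hx, hy, hz, hxy, zero_smul, one_smul, mul_zero, sub_zero, add_zero] at hs h1 h2' h3
  generalize x.1 = x at *
  generalize y.1 = y at *
  generalize z.1 = z at *
  have hyx := eq_neg_of_add_eq_zero_right hs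
  have hyxy : y * (x * y) = x := by rw [← mul_assoc, hyx, neg_mul, mul_assoc, hy2]; simp
  have hzxy : z * (x * y) = x * z := by
    rw [← mul_assoc, hzx, mul_assoc, hzy, ← mul_assoc, hyxy]
  have ht2 : (z * y).trace = (z * x).trace := by rw [hzx, Matrix.trace_mul_comm]
  have ht3 : (z * (x * y)).trace = (z * x).trace := by rw [hzxy, Matrix.trace_mul_comm]
  rw [ht2] at h2'
  rw [ht3] at h3
  generalize (z * x).trace = t at *
  rw [hzx] at h1
  rw [hzy] at h2'
  rw [hzxy] at h3
  have e1 : (2 : F) • (x * z) = x - y + x * y + t • 1 := by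
    linear_combination (norm := module) h1 - h2' + h3
  have e2 : (2 : F) • (y * z) = x + y - x * y + t • 1 := by
    linear_combination (norm := module) h1 + h2' - h3
  replace e1 := congrArg (x * ·) e1
  replace e2 := congrArg (y * ·) e2
  simp only [mul_smul_comm, mul_add, mul_sub, ← mul_assoc x x, ← mul_assoc y y, hx2, hy2, hyxy,
    neg_mul, one_mul, mul_one, hyx] at e1 e2
  have e3 : (1 + t) • (x - y) = 0 := by
    linear_combination (norm := module) e2 - e1
  rcases smul_eq_zero.mp e3 with h | h
  · linear_combination (norm := module) -e1 - h • x
  · rw [← sub_eq_zero.mp h, hx2, neg_neg] at hyx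
    have := congrFun (congrFun hyx 0) 0
    simp at this
    exact absurd (by linear_combination -this) h2

end Quaternion

section Tetrahedral

open Quaternion

variable {F : Type*} [Field F]

/-- The quaternion of norm one with the given coordinates. -/
def Quaternion.unit {R : Type*} [CommRing R] (a b c d : R) (h : a ^ 2 + b ^ 2 + c ^ 2 + d ^ 2 = 1) :
    unitary ℍ[R] :=
  let q : ℍ[R] := ⟨a, b, c, d⟩
  have hq : normSq q = 1 := (Quaternion.normSq_def' q).trans h
  ⟨q, by
    rw [Unitary.mem_iff, Quaternion.star_mul_self, Quaternion.self_mul_star, hq]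
    exact ⟨map_one (algebraMap R ℍ[R]), map_one (algebraMap R ℍ[R])⟩⟩

lemma Quaternion.unit_mul_eq {R : Type*} [CommRing R] {a b c d a' b' c' d' : R}
    {h : a ^ 2 + b ^ 2 + c ^ 2 + d ^ 2 = 1} {h' : a' ^ 2 + b' ^ 2 + c' ^ 2 + d' ^ 2 = 1}
    {u v w z : R} (hu : u = a * a' - b * b' - c * c' - d * d')
    (hv : v = a * b' + b * a' + c * d' - d * c') (hw : w = a * c' - b * d' + c * a' + d * b')
    (hz : z = a * d' + b * c' - c * b' + d * a') (h'' : u ^ 2 + v ^ 2 + w ^ 2 + z ^ 2 = 1) :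
    Quaternion.unit a b c d h * Quaternion.unit a' b' c' d' h' = Quaternion.unit u v w z h'' := by
  subst hu hv hw hz
  refine Subtype.ext ?_
  rw [Submonoid.coe_mul]
  ext
  · rw [Quaternion.re_mul]; rfl
  · rw [Quaternion.imI_mul]; rfl
  · rw [Quaternion.imJ_mul]; rfl
  · rw [Quaternion.imK_mul]; rfl

lemma Quaternion.exists_unit_mem {R : Type*} [CommRing R] {H : Subgroup (unitary ℍ[R])}
    {a b c d a' b' c' d' : R} (h : ∃ h, Quaternion.unit a b c d h ∈ H)
    (h' : ∃ h, Quaternion.unit a' b' c' d' h ∈ H) {u v w z : R}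
    (hu : u = a * a' - b * b' - c * c' - d * d') (hv : v = a * b' + b * a' + c * d' - d * c')
    (hw : w = a * c' - b * d' + c * a' + d * b') (hz : z = a * d' + b * c' - c * b' + d * a') :
    ∃ h, Quaternion.unit u v w z h ∈ H := by
  obtain ⟨h, hm⟩ := h
  obtain ⟨h', h_mem⟩ := h'
  have huvwz : u ^ 2 + v ^ 2 + w ^ 2 + z ^ 2 = 1 := by
    subst hu hv hw hz
    linear_combination (a' ^ 2 + b' ^ 2 + c' ^ 2 + d' ^ 2) * h + h'
  exact ⟨huvwz, Quaternion.unit_mul_eq hu hv hw hz huvwz ▸ mul_mem hm h_mem⟩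

/-- A few Hurwitz units generated by `i` and `(1 + i + j + k) / 2`. -/
lemma Quaternion.hurwitz_units_mem {R : Type*} [CommRing R] {t : R} (ht : 2 * t = 1)
    {H : Subgroup (unitary ℍ[R])} (hi : ∃ h, Quaternion.unit 0 1 0 0 h ∈ H)
    (hc : ∃ h, Quaternion.unit t t t t h ∈ H) :
    (∃ h, Quaternion.unit (-t) t t t h ∈ H) ∧ (∃ h, Quaternion.unit (-t) t (-t) t h ∈ H) ∧
    (∃ h, Quaternion.unit (-t) t (-t) (-t) h ∈ H) ∧
    (∃ h, Quaternion.unit (-t) (-t) (-t) t h ∈ H) ∧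
    (∃ h, Quaternion.unit (-t) (-t) t (-t) h ∈ H) ∧ (∃ h, Quaternion.unit (-t) t t (-t) h ∈ H) ∧
    (∃ h, Quaternion.unit t t (-t) (-t) h ∈ H) ∧ (∃ h, Quaternion.unit 0 0 (-(2 * t)) 0 h ∈ H) := by
  have h1 : ∃ h, Quaternion.unit (-t) t t t h ∈ H := by
    apply Quaternion.exists_unit_mem hc hc <;> grind
  have h2 : ∃ h, Quaternion.unit (-t) t (-t) t h ∈ H := by
    apply Quaternion.exists_unit_mem hi hc <;> grind
  have h4 : ∃ h, Quaternion.unit (-t) (-t) (-t) t h ∈ H := by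
    apply Quaternion.exists_unit_mem hi h1 <;> grind
  refine ⟨h1, h2, ?_, h4, ?_, ?_, ?_, ?_⟩
  · apply Quaternion.exists_unit_mem hc h2 <;> grind
  · apply Quaternion.exists_unit_mem h1 hi <;> grind
  · apply Quaternion.exists_unit_mem hc hi <;> grind
  · apply Quaternion.exists_unit_mem h1 h4 <;> grind
  · apply Quaternion.exists_unit_mem hc h4 <;> grind

lemma Quaternion.exists_mul_eq_mul_pow {R : Type*} [CommRing R] {H : Subgroup (unitary ℍ[R])}
    {q : unitary ℍ[R]} {j k : ℕ} {a b c d a' b' c' d' u v w z u' v' w' z' : R}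
    (hj : ∃ h, q ^ j = Quaternion.unit a b c d h) {h' : a' ^ 2 + b' ^ 2 + c' ^ 2 + d' ^ 2 = 1}
    (hH : ∃ h, Quaternion.unit u v w z h ∈ H) (hk : ∃ h, q ^ k = Quaternion.unit u' v' w' z' h)
    {e : R} (he : e = 1 ∨ e = -1)
    (hre : a * a' - b * b' - c * c' - d * d' = e * (u * u' - v * v' - w * w' - z * z'))
    (hI : a * b' + b * a' + c * d' - d * c' = e * (u * v' + v * u' + w * z' - z * w'))
    (hJ : a * c' - b * d' + c * a' + d * b' = e * (u * w' - v * z' + w * u' + z * v'))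
    (hK : a * d' + b * c' - c * b' + d * a' = e * (u * z' + v * w' - w * v' + z * u')) :
    ∃ m ∈ H, ∃ k : ℕ, (q ^ j * Quaternion.unit a' b' c' d' h').1 = (m * q ^ k).1 ∨
      (q ^ j * Quaternion.unit a' b' c' d' h').1 = -(m * q ^ k).1 := by
  obtain ⟨h1, hj⟩ := hj
  obtain ⟨h2, hk⟩ := hk
  obtain ⟨h3, hm⟩ := hH
  refine ⟨_, hm, k, ?_⟩
  rw [hj, hk, Submonoid.coe_mul, Submonoid.coe_mul]
  rcases he with rfl | rfl
  · left
    simp only [one_mul] at hre hI hJ hK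
    ext
    · rw [Quaternion.re_mul, Quaternion.re_mul]; exact hre
    · rw [Quaternion.imI_mul, Quaternion.imI_mul]; exact hI
    · rw [Quaternion.imJ_mul, Quaternion.imJ_mul]; exact hJ
    · rw [Quaternion.imK_mul, Quaternion.imK_mul]; exact hK
  · right
    simp only [neg_one_mul] at hre hI hJ hK
    ext
    · rw [Quaternion.re_neg, Quaternion.re_mul, Quaternion.re_mul]; exact hre
    · rw [Quaternion.imI_neg, Quaternion.imI_mul, Quaternion.imI_mul]; exact hI
    · rw [Quaternion.imJ_neg, Quaternion.imJ_mul, Quaternion.imJ_mul]; exact hJ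
    · rw [Quaternion.imK_neg, Quaternion.imK_mul, Quaternion.imK_mul]; exact hK

lemma Quaternion.exists_pow_add_eq {R : Type*} [CommRing R] {q : unitary ℍ[R]} {i j : ℕ}
    {a b c d a' b' c' d' : R} (h : ∃ h, q ^ i = Quaternion.unit a b c d h)
    (h' : ∃ h, q ^ j = Quaternion.unit a' b' c' d' h) {u v w z : R}
    (hu : u = a * a' - b * b' - c * c' - d * d') (hv : v = a * b' + b * a' + c * d' - d * c')
    (hw : w = a * c' - b * d' + c * a' + d * b') (hz : z = a * d' + b * c' - c * b' + d * a') :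
    ∃ h, q ^ (i + j) = Quaternion.unit u v w z h := by
  obtain ⟨h, hm⟩ := h
  obtain ⟨h', hm'⟩ := h'
  have huvwz : u ^ 2 + v ^ 2 + w ^ 2 + z ^ 2 = 1 := by
    subst hu hv hw hz
    linear_combination (a' ^ 2 + b' ^ 2 + c' ^ 2 + d' ^ 2) * h + h'
  exact ⟨huvwz, by rw [pow_add, hm, hm', Quaternion.unit_mul_eq hu hv hw hz huvwz]⟩

/-- A tetrahedral subgroup of `PSL₂` is the image of the group of Hurwitz units. -/
lemma PSL2.exists_unitary_hom (h2 : (2 : F) ≠ 0) {M : Subgroup PSL(2, F)}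
    (e : M ≃* alternatingGroup (Fin 4)) :
    ∃ f : unitary ℍ[F] →* PSL(2, F), (∀ q q', (q.1 = q'.1 ∨ q.1 = -q'.1) → f q = f q') ∧
      (∀ q, f q = 1 → q.1.re ^ 2 = 1) ∧ ∃ hi hc,
        Subgroup.closure {f (Quaternion.unit 0 1 0 0 hi),
          f (Quaternion.unit (1 / 2) (1 / 2) (1 / 2) (1 / 2) hc)} = M := by
  obtain ⟨a, c, hM, ha1, ha, hc1, hc, hb1, hb, hcb⟩ := exists_generators_of_alternatingGroup_four e
  obtain ⟨C, hCc, hC⟩ : ∃ C : SL(2, F), (C : PSL(2, F)) = c ∧ C.1.trace = 1 := by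
    obtain ⟨C, rfl⟩ := QuotientGroup.mk_surjective c
    rcases sq_eq_one_iff.mp (PSL2.trace_sq_of_cube hc1 hc) with h | h
    · exact ⟨C, rfl, h⟩
    · exact ⟨-C, PSL2.mk_eq_mk_iff.mpr (.inr rfl), by rw [SL2.trace_neg, h, neg_neg]⟩
  obtain ⟨I, hIa, hI⟩ : ∃ I : SL(2, F), (I : PSL(2, F)) = a ∧
      C * (C * I * C⁻¹) * C⁻¹ = I * (C * I * C⁻¹) := by
    obtain ⟨I, rfl⟩ := QuotientGroup.mk_surjective a
    subst hCc
    have : ((C * (C * I * C⁻¹) * C⁻¹ : SL(2, F)) : PSL(2, F)) =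
      (I * (C * I * C⁻¹) : SL(2, F)) := hcb
    rcases PSL2.mk_eq_mk_iff.mp this with h | h
    · exact ⟨I, rfl, h⟩
    · refine ⟨-I, PSL2.mk_eq_mk_iff.mpr (.inr rfl), ?_⟩
      simp only [mul_neg, neg_mul, neg_neg]
      rw [h, neg_neg]
  subst hCc hIa
  have hx : I.1.trace = 0 := PSL2.trace_eq_zero_of_sq ha1 ha
  have hy : (C * I * C⁻¹).1.trace = 0 := by
    rw [SL2.trace_mul_comm, ← mul_assoc, inv_mul_cancel, one_mul, hx]
  have hxy : (I * (C * I * C⁻¹)).1.trace = 0 := PSL2.trace_eq_zero_of_sq hb1 hb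
  obtain ⟨f, hf, hdet, htr⟩ := SL2.exists_quaternion_hom hx hy hxy
  have hCq := SL2.two_smul_eq h2 hx hy hxy hC (by group) (by rw [← hI]; group)
  let g : unitary ℍ[F] →* SL(2, F) :=
    { toFun := fun q => ⟨f q.1, by
        rw [hdet]
        have := Unitary.mul_star_self_of_mem q.2
        rw [Quaternion.self_mul_star] at this
        exact congrArg QuaternionAlgebra.re this⟩
      map_one' := Subtype.ext (map_one f)
      map_mul' := fun q q' => Subtype.ext (map_mul f _ _) }
  have hgi : ∀ h, g (Quaternion.unit 0 1 0 0 h) = I := by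
    intro h
    refine Subtype.ext ((hf _).trans ?_)
    simp [Quaternion.unit]
  have hgc : ∀ h, g (Quaternion.unit (1 / 2) (1 / 2) (1 / 2) (1 / 2) h) = C := by
    intro h
    refine Subtype.ext ((hf _).trans (smul_right_injective _ h2 ?_))
    dsimp only [Quaternion.unit]
    rw [hCq]
    simp only [smul_add, smul_smul, mul_one_div_cancel h2, one_smul]
  refine ⟨(QuotientGroup.mk' _).comp g, ?_, ?_, by simp, by field_simp; norm_num, ?_⟩
  · intro q q' h
    refine PSL2.mk_eq_mk_iff.mpr (h.imp (fun h => congrArg g (Subtype.ext h)) fun h => ?_)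
    refine Subtype.ext ?_
    change f q.1 = -f q'.1
    rw [h, map_neg]
  · intro q h
    have : q.1.re = 1 ∨ q.1.re = -1 := by
      have ht : (g q).1.trace = 2 * q.1.re := htr _
      rcases PSL2.mk_eq_one_iff.mp h with h | h <;> rw [h] at ht
      · left
        refine mul_left_cancel₀ h2 ?_
        rw [← ht]; simp
      · right
        refine mul_left_cancel₀ h2 ?_
        rw [← ht]; simp
    exact sq_eq_one_iff.mpr this
  · rw [← hM, MonoidHom.comp_apply, MonoidHom.comp_apply, hgi, hgc]
    rfl

/-- A maximal tetrahedral subgroup of `PSL₂` leaves room for at most `12 * n` elements when there is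
a suitable element `w` of order `n` outside of it. -/
lemma PSL2.card_le_of_unitary_hom [Finite F] {M : Subgroup PSL(2, F)} (hM : IsCoatom M)
    (e : M ≃* alternatingGroup (Fin 4)) {f : unitary ℍ[F] →* PSL(2, F)}
    (hf : ∀ q q', (q.1 = q'.1 ∨ q.1 = -q'.1) → f q = f q') (hf1 : ∀ q, f q = 1 → q.1.re ^ 2 = 1)
    {S : Set (unitary ℍ[F])} (hS : Subgroup.closure (f '' S) = M) {w : unitary ℍ[F]} {n : ℕ}
    (hn : 0 < n) (hwn : (w ^ n).1 = -1) (hw6 : (w ^ 6).1.re ^ 2 ≠ 1)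
    (h : ∀ g ∈ S, ∀ j < n, 0 < j → ∃ m ∈ Subgroup.closure S, ∃ k : ℕ,
      (w ^ j * g).1 = (m * w ^ k).1 ∨ (w ^ j * g).1 = -(m * w ^ k).1) :
    Nat.card PSL(2, F) ≤ 12 * n := by
  have hcard : Nat.card M = 12 := by
    rw [Nat.card_congr e.toEquiv, nat_card_alternatingGroup]
    simp [Nat.factorial]
  rw [← hcard]
  have hwM : f w ∉ M := by
    intro hw
    have h6 : (⟨f w, hw⟩ : M) ^ 6 = 1 := e.injective (by
      rw [map_pow, alternatingGroup_four_pow_six, map_one])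
    refine hw6 (hf1 _ ?_)
    rw [map_pow]
    exact congrArg Subtype.val h6
  refine card_le_of_isCoatom hM hS hwM hn ?_ ?_
  · rw [← map_pow, ← map_one f]
    exact hf _ _ (.inr hwn)
  · rintro _ ⟨g, hg, rfl⟩ j hj
    rcases j.eq_zero_or_pos with rfl | hj0
    · exact ⟨f g, hS ▸ Subgroup.subset_closure (Set.mem_image_of_mem f hg), 0, by simp⟩
    obtain ⟨m, hm, k, h⟩ := h g hg j hj hj0
    refine ⟨f m, ?_, k, ?_⟩
    · rw [← hS, ← MonoidHom.map_closure]
      exact Subgroup.mem_map_of_mem f hm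
    · rw [← map_pow, ← map_pow, ← map_mul, ← map_mul]
      exact hf _ _ h

lemma PSL2.card_le_of_sq_eq_two [Finite F] (h2 : (2 : F) ≠ 0) {M : Subgroup PSL(2, F)}
    (hM : IsCoatom M) (e : M ≃* alternatingGroup (Fin 4)) {r : F} (hr : r ^ 2 = 2) :
    Nat.card PSL(2, F) ≤ 12 * 4 := by
  obtain ⟨f, hf, hf1, hi, hc, hS⟩ := PSL2.exists_unitary_hom h2 e
  obtain ⟨s, hs⟩ : ∃ s : F, 2 * s ^ 2 = 1 := ⟨r / 2, by field_simp; exact hr⟩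
  obtain ⟨t, ht⟩ : ∃ t : F, 1 / 2 = t := ⟨_, rfl⟩
  have h2t : 2 * t = 1 := by rw [← ht]; field_simp
  simp only [ht] at hc hS
  rw [← Set.image_pair] at hS
  have hw : s ^ 2 + s ^ 2 + 0 ^ 2 + 0 ^ 2 = 1 := by linear_combination hs
  have hw1 : ∃ h, Quaternion.unit s s 0 0 hw ^ 1 = Quaternion.unit s s 0 0 h := ⟨hw, pow_one _⟩
  have hw2 : ∃ h, Quaternion.unit s s 0 0 hw ^ 2 = Quaternion.unit 0 1 0 0 h := by
    apply Quaternion.exists_pow_add_eq hw1 hw1 <;>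
      first | ring1 | linear_combination hs | linear_combination -hs
  have hw3 : ∃ h, Quaternion.unit s s 0 0 hw ^ 3 = Quaternion.unit (-s) s 0 0 h := by
    apply Quaternion.exists_pow_add_eq hw1 hw2 <;> ring
  have hw4 : ∃ h, Quaternion.unit s s 0 0 hw ^ 4 = Quaternion.unit (-1) 0 0 0 h := by
    apply Quaternion.exists_pow_add_eq hw2 hw2 <;> ring
  obtain ⟨_, hw6⟩ : ∃ h, Quaternion.unit s s 0 0 hw ^ 6 = Quaternion.unit 0 (-1) 0 0 h := by
    apply Quaternion.exists_pow_add_eq hw2 hw4 <;> ring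
  have hiS := Subgroup.subset_closure (Set.mem_insert (Quaternion.unit 0 1 0 0 hi)
    {Quaternion.unit t t t t hc})
  have hcS := Subgroup.subset_closure (Set.mem_insert_of_mem (Quaternion.unit 0 1 0 0 hi)
    (Set.mem_singleton (Quaternion.unit t t t t hc)))
  obtain ⟨-, hic, hcic, -, hcci, -, -, -⟩ := Quaternion.hurwitz_units_mem h2t ⟨hi, hiS⟩ ⟨hc, hcS⟩
  refine PSL2.card_le_of_unitary_hom hM e hf hf1 hS four_pos (w := Quaternion.unit s s 0 0 hw) ?_ ?_
    ?_
  · obtain ⟨_, hw4⟩ := hw4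
    rw [hw4]
    ext <;> simp [Quaternion.unit]
  · rw [hw6]
    simp [Quaternion.unit]
  rintro g (rfl | rfl) j hj hj0 <;> interval_cases j
  · apply Quaternion.exists_mul_eq_mul_pow hw1 ⟨hi, hiS⟩ hw1 (.inl rfl) <;> ring
  · apply Quaternion.exists_mul_eq_mul_pow hw2 ⟨hi, hiS⟩ hw2 (.inl rfl) <;> ring
  · apply Quaternion.exists_mul_eq_mul_pow hw3 ⟨hi, hiS⟩ hw3 (.inl rfl) <;> ring
  · apply Quaternion.exists_mul_eq_mul_pow hw1 hcci hw1 (.inr rfl) <;> ring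
  · apply Quaternion.exists_mul_eq_mul_pow hw2 hic hw4 (.inr rfl) <;> ring
  · apply Quaternion.exists_mul_eq_mul_pow hw3 hcic hw1 (.inl rfl) <;> ring

lemma PSL2.card_le_of_sq_eq_five [Finite F] (h2 : (2 : F) ≠ 0) (h5 : (5 : F) ≠ 0)
    {M : Subgroup PSL(2, F)} (hM : IsCoatom M) (e : M ≃* alternatingGroup (Fin 4)) {r : F}
    (hr : r ^ 2 = 5) : Nat.card PSL(2, F) ≤ 12 * 5 := by
  obtain ⟨f, hf, hf1, hi, hc, hS⟩ := PSL2.exists_unitary_hom h2 e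
  obtain ⟨u, hu⟩ : ∃ u : F, u ^ 2 = u + 1 := ⟨(1 + r) / 2, by field_simp; linear_combination hr⟩
  obtain ⟨t, ht⟩ : ∃ t : F, 1 / 2 = t := ⟨_, rfl⟩
  have h2t : 2 * t = 1 := by rw [← ht]; field_simp
  simp only [ht] at hc hS
  obtain ⟨hi', hi2⟩ : ∃ h, Quaternion.unit 0 1 0 0 hi = Quaternion.unit 0 (2 * t) 0 0 h :=
    ⟨by rw [h2t]; exact hi, by simp only [h2t]⟩
  rw [← Set.image_pair, hi2] at hS
  have hw : (u * t) ^ 2 + ((u - 1) * t) ^ 2 + t ^ 2 + 0 ^ 2 = 1 := by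
    linear_combination 2 * t ^ 2 * hu + (2 * t + 1) * h2t
  have hw1 : ∃ h, Quaternion.unit (u * t) ((u - 1) * t) t 0 hw ^ 1 =
      Quaternion.unit (u * t) ((u - 1) * t) t 0 h := ⟨hw, pow_one _⟩
  have hw2 : ∃ h, Quaternion.unit (u * t) ((u - 1) * t) t 0 hw ^ 2 =
      Quaternion.unit ((u - 1) * t) t (u * t) 0 h := by
    apply Quaternion.exists_pow_add_eq hw1 hw1 <;> grind
  have hw3 : ∃ h, Quaternion.unit (u * t) ((u - 1) * t) t 0 hw ^ 3 =
      Quaternion.unit (-(u - 1) * t) t (u * t) 0 h := by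
    apply Quaternion.exists_pow_add_eq hw1 hw2 <;> grind
  have hw4 : ∃ h, Quaternion.unit (u * t) ((u - 1) * t) t 0 hw ^ 4 =
      Quaternion.unit (-u * t) ((u - 1) * t) t 0 h := by
    apply Quaternion.exists_pow_add_eq hw2 hw2 <;> grind
  have hw5 : ∃ h, Quaternion.unit (u * t) ((u - 1) * t) t 0 hw ^ 5 =
      Quaternion.unit (-1) 0 0 0 h := by
    apply Quaternion.exists_pow_add_eq hw2 hw3 <;> grind
  obtain ⟨_, hw6⟩ : ∃ h, Quaternion.unit (u * t) ((u - 1) * t) t 0 hw ^ 6 =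
      Quaternion.unit (-u * t) (-(u - 1) * t) (-t) 0 h := by
    apply Quaternion.exists_pow_add_eq hw1 hw5 <;> ring
  have hiS := Subgroup.subset_closure (Set.mem_insert (Quaternion.unit 0 (2 * t) 0 0 hi')
    {Quaternion.unit t t t t hc})
  have hcS := Subgroup.subset_closure (Set.mem_insert_of_mem (Quaternion.unit 0 (2 * t) 0 0 hi')
    (Set.mem_singleton (Quaternion.unit t t t t hc)))
  obtain ⟨hcc, hic, hcic, hicc, hcci, hci, hccicc, hcicc⟩ :=
    Quaternion.hurwitz_units_mem h2t ⟨hi, hi2 ▸ hiS⟩ ⟨hc, hcS⟩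
  refine PSL2.card_le_of_unitary_hom hM e hf hf1 hS (by norm_num)
    (w := Quaternion.unit (u * t) ((u - 1) * t) t 0 hw) (n := 5) ?_ ?_ ?_
  · obtain ⟨_, hw5⟩ := hw5
    rw [hw5]
    ext <;> simp [Quaternion.unit]
  · rw [hw6]
    change (-u * t) ^ 2 ≠ 1
    intro h
    apply h5
    have h4 : u ^ 2 = 4 := by grind
    grind
  rintro g (rfl | rfl) j hj hj0 <;> interval_cases j
  · apply Quaternion.exists_mul_eq_mul_pow hw1 hic hw3 (.inr rfl) <;> ring
  · apply Quaternion.exists_mul_eq_mul_pow hw2 hcic hw4 (.inr rfl) <;> ring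
  · apply Quaternion.exists_mul_eq_mul_pow hw3 hcci hw1 (.inl rfl) <;> ring
  · apply Quaternion.exists_mul_eq_mul_pow hw4 hccicc hw2 (.inr rfl) <;> ring
  · apply Quaternion.exists_mul_eq_mul_pow hw1 hcc hw4 (.inr rfl) <;> ring
  · apply Quaternion.exists_mul_eq_mul_pow hw2 hicc hw2 (.inr rfl) <;> ring
  · apply Quaternion.exists_mul_eq_mul_pow hw3 hci hw1 (.inl rfl) <;> ring
  · apply Quaternion.exists_mul_eq_mul_pow hw4 hcicc hw3 (.inr rfl) <;> ring

end Tetrahedral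

section Residues

lemma ZMod.not_isSquare_two_of_lt_seven : ∀ q < 7, q.Prime → (2 : ZMod q) ≠ 0 →
    ∀ r : ZMod q, 2 ≠ r * r := by
  intro q hq hq'
  interval_cases q <;> first | (exfalso; revert hq'; decide) | decide

lemma ZMod.not_isSquare_five_of_lt_eight : ∀ q < 8, q.Prime → (2 : ZMod q) ≠ 0 →
    (5 : ZMod q) ≠ 0 → ∀ r : ZMod q, 5 ≠ r * r := by
  intro q hq hq'
  interval_cases q <;> first | (exfalso; revert hq'; decide) | decide

variable {p : ℕ} [Fact p.Prime] {M : Subgroup PSL(2, ZMod p)}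

lemma PSL2.not_isSquare_two (h2 : (2 : ZMod p) ≠ 0) (hM : IsCoatom M)
    (e : M ≃* alternatingGroup (Fin 4)) : ¬ IsSquare (2 : ZMod p) := by
  rintro ⟨r, hr⟩
  have h := (PSL2.sq_le_card h2).trans (PSL2.card_le_of_sq_eq_two h2 hM e (by rw [hr, sq]))
  exact ZMod.not_isSquare_two_of_lt_seven p (by nlinarith) Fact.out h2 r hr

lemma PSL2.not_isSquare_five (h2 : (2 : ZMod p) ≠ 0) (h5 : (5 : ZMod p) ≠ 0) (hM : IsCoatom M)
    (e : M ≃* alternatingGroup (Fin 4)) : ¬ IsSquare (5 : ZMod p) := by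
  rintro ⟨r, hr⟩
  have h := (PSL2.sq_le_card h2).trans (PSL2.card_le_of_sq_eq_five h2 h5 hM e (by rw [hr, sq]))
  exact ZMod.not_isSquare_five_of_lt_eight p (by nlinarith) Fact.out h2 h5 r hr

end Residues

section Dickson

variable {p : ℕ} [Fact p.Prime] {H : Subgroup PSL(2, ZMod p)}

lemma PSL2.trace_sq_ne_four (hH : ¬ p ∣ Nat.card H) {g : SL(2, ZMod p)}
    (hg : (g : PSL(2, ZMod p)) ∈ H) (h1 : (g : PSL(2, ZMod p)) ≠ 1) : g.1.trace ^ 2 ≠ 4 := by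
  intro h
  have := H.orderOf_dvd_natCard hg
  rw [orderOf_eq_prime (PSL2.pow_char_of_parabolic h) h1] at this
  exact hH this

variable {K : Type*} [Field K] [Algebra (ZMod p) K]

lemma PSL2.commute_of_fixed (h2 : (2 : ZMod p) ≠ 0) (hH : ¬ p ∣ Nat.card H) {g h : SL(2, ZMod p)}
    (hg : (g : PSL(2, ZMod p)) ∈ H) (hh : (h : PSL(2, ZMod p)) ∈ H) {P : OnePoint K}
    (hgP : PSL2.toPerm (ZMod p) K g P = P) (hhP : PSL2.toPerm (ZMod p) K h P = P) :
    g * h = h * g := by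
  have ht := SL2.trace_commutator_of_fixed hgP hhP
  have h1 : ((g * h * g⁻¹ * h⁻¹ : SL(2, ZMod p)) : PSL(2, ZMod p)) = 1 := by
    by_contra h1
    refine PSL2.trace_sq_ne_four hH ?_ h1 (by rw [ht]; norm_num)
    exact H.mul_mem (H.mul_mem (H.mul_mem hg hh) (H.inv_mem hg)) (H.inv_mem hh)
  rcases PSL2.mk_eq_one_iff.mp h1 with h1 | h1
  · rwa [mul_inv_eq_one, mul_inv_eq_iff_eq_mul] at h1
  · rw [h1, SL2.trace_neg] at ht
    have h4 : (2 : ZMod p) * 2 = 0 := by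
      simp at ht
      linear_combination -ht
    simp [h2] at h4

lemma ZMod.isSquare_algebraMap_galoisField_two (hp2 : p ≠ 2) (a : ZMod p) :
    IsSquare (algebraMap (ZMod p) (GaloisField p 2) a) := by
  have hp := (Fact.out : p.Prime)
  have := Fintype.ofFinite (GaloisField p 2)
  by_cases ha : a = 0
  · simp [ha]
  have hch : ringChar (GaloisField p 2) = p := (ringChar.eq_iff).mpr inferInstance
  rw [FiniteField.isSquare_iff (by rwa [hch]) (by simpa using ha), ← Nat.card_eq_fintype_card,
    GaloisField.card p 2 two_ne_zero, ← map_pow]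
  obtain ⟨k, hk⟩ := hp.odd_of_ne_two hp2
  have : p ^ 2 / 2 = (p - 1) * (k + 1) := by
    rw [hk]
    have : (2 * k + 1) ^ 2 = 2 * (2 * k * (k + 1)) + 1 := by ring
    rw [this]
    simp
    omega
  rw [this, pow_mul, ZMod.pow_card_sub_one_eq_one ha, one_pow, map_one]

lemma PSL2.ncard_fixed_points_of_mem (hp2 : p ≠ 2) (hH : ¬ p ∣ Nat.card H)
    {g : PSL(2, ZMod p)} (hg : g ∈ H) (h1 : g ≠ 1) :
    {P | PSL2.toPerm (ZMod p) (GaloisField p 2) g P = P}.ncard = 2 := by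
  obtain ⟨g, rfl⟩ := QuotientGroup.mk_surjective g
  obtain ⟨s, hs⟩ := ZMod.isSquare_algebraMap_galoisField_two hp2 (g.1.trace ^ 2 - 4)
  have h2 : (2 : GaloisField p 2) ≠ 0 := by
    have := Ring.two_ne_zero (R := GaloisField p 2) (by
      rwa [(ringChar.eq_iff (p := p)).mpr inferInstance])
    exact this
  refine SL2.ncard_fixed_points h2 (s := s) ?_ (by rw [hs, sq])
  rintro rfl
  rw [mul_zero, map_eq_zero] at hs
  exact PSL2.trace_sq_ne_four hH hg h1 (sub_eq_zero.mp hs)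

/-- Two commuting elements of trace zero in `SL₂` have the same image in `PSL₂`. -/
lemma PSL2.eq_of_commute_of_trace_eq_zero (h2 : (2 : ZMod p) ≠ 0) {g h : SL(2, ZMod p)}
    (hc : g * h = h * g) (hg : g.1.trace = 0) (hh : h.1.trace = 0) :
    (g : PSL(2, ZMod p)) = h := by
  by_contra hne
  have hsq : (g * h⁻¹) ^ 2 = 1 := by
    have hc' : Commute g h⁻¹ := Commute.inv_right hc
    rw [hc'.mul_pow, inv_pow, SL2.sq_eq_neg_one hg, SL2.sq_eq_neg_one hh, mul_inv_cancel]
  have h0 : (g * h⁻¹).1.trace = 0 := by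
    refine PSL2.trace_eq_zero_of_sq ?_ (by rw [← QuotientGroup.mk_pow, hsq, QuotientGroup.mk_one])
    rwa [QuotientGroup.mk_mul, QuotientGroup.mk_inv, ne_eq, mul_inv_eq_one]
  have h1 := SL2.sq_eq_neg_one h0
  rw [hsq] at h1
  have h10 := congrArg (fun k : SL(2, ZMod p) => k.1 0 0) h1
  simp only [Matrix.SpecialLinearGroup.coe_one, Matrix.SpecialLinearGroup.coe_neg] at h10
  simp at h10
  exact h2 (by linear_combination h10)

/-- If four elements fix a common point of the projective line, one of them has order four. -/
lemma PSL2.isSquare_two_of_card_eq_four (h2 : (2 : ZMod p) ≠ 0) (hH : ¬ p ∣ Nat.card H)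
    {P : OnePoint K} {S : Subgroup H} (hS : ∀ g ∈ S, PSL2.toPerm (ZMod p) K g P = P)
    (h4 : Nat.card S = 4) : IsSquare (2 : ZMod p) := by
  by_contra hsq
  have key : ∀ g ∈ S, g ^ 2 = 1 := by
    intro g hg
    have h := S.orderOf_dvd_natCard hg
    rw [h4] at h
    have h4' : orderOf g ≠ 4 := by
      intro h'
      obtain ⟨g, hgH⟩ := g
      obtain ⟨g, rfl⟩ := QuotientGroup.mk_surjective g
      rw [Subgroup.orderOf_mk] at h'
      exact hsq ⟨g.1.trace, by rw [← sq, PSL2.trace_sq_of_order_four h']⟩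
    apply orderOf_dvd_iff_pow_eq_one.mp
    have := Nat.le_of_dvd (by norm_num) h
    interval_cases orderOf g <;> omega
  have huniq : ∀ g ∈ S, ∀ h ∈ S, g ≠ 1 → h ≠ 1 → g = h := by
    rintro ⟨g, hgH⟩ hg ⟨h, hhH⟩ hh hg1 hh1
    have hg2 := key _ hg
    have hh2 := key _ hh
    obtain ⟨g, rfl⟩ := QuotientGroup.mk_surjective g
    obtain ⟨h, rfl⟩ := QuotientGroup.mk_surjective h
    simp only [SubmonoidClass.mk_pow, Subgroup.mk_eq_one, ne_eq, Subtype.mk.injEq]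
      at hg2 hh2 hg1 hh1 ⊢
    exact PSL2.eq_of_commute_of_trace_eq_zero h2
      (PSL2.commute_of_fixed h2 hH hgH hhH (hS _ hg) (hS _ hh))
      (PSL2.trace_eq_zero_of_sq hg1 hg2) (PSL2.trace_eq_zero_of_sq hh1 hh2)
  have hfin : Finite S := Nat.finite_of_card_ne_zero (by omega)
  have := Fintype.ofFinite S
  rw [Nat.card_eq_fintype_card] at h4
  obtain ⟨a, b, c, hab, hac, hbc⟩ := (Fintype.two_lt_card_iff (α := S)).mp (by omega)
  have huniq' : ∀ g h : S, g ≠ 1 → h ≠ 1 → g = h := fun g h hg hh =>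
    Subtype.ext (huniq g g.2 h h.2 (by simpa using hg) (by simpa using hh))
  by_cases ha : a = 1
  · subst ha
    exact hbc (huniq' b c hab.symm hac.symm)
  by_cases hb : b = 1
  · subst hb
    exact hac (huniq' a c ha hbc.symm)
  · exact hab (huniq' a b ha hb)

lemma PSL2.isSquare_five_of_card_eq_five {S : Subgroup H} (h5 : Nat.card S = 5) :
    IsSquare (5 : ZMod p) := by
  have : Fact (Nat.Prime 5) := ⟨by norm_num⟩
  have : Finite S := Nat.finite_of_card_ne_zero (by omega)
  obtain ⟨⟨⟨g, hgH⟩, hg⟩, h⟩ := exists_prime_orderOf_dvd_card' (G := S) 5 (by rw [h5])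
  rw [Subgroup.orderOf_mk, Subgroup.orderOf_mk] at h
  obtain ⟨g, rfl⟩ := QuotientGroup.mk_surjective g
  exact ⟨_, by rw [← sq, PSL2.trace_of_order_five h]⟩

lemma PSL2.mul_comm_or_trace_mul_eq_zero (h2 : (2 : ZMod p) ≠ 0) (hH : ¬ p ∣ Nat.card H)
    {X Y : SL(2, ZMod p)} (hX : ¬ IsSquare (X.1.trace ^ 2 - 4)) (hY : Y.1.trace = 0)
    (hXH : (X : PSL(2, ZMod p)) ∈ H) (hYH : (Y : PSL(2, ZMod p)) ∈ H) {P : OnePoint K}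
    (hXP : PSL2.toPerm (ZMod p) K X P = P) (hXY : PSL2.toPerm (ZMod p) K (Y⁻¹ * X * Y) P = P) :
    X * Y = Y * X ∨ (X * Y).1.trace = 0 := by
  have hc : X * (Y⁻¹ * X * Y) = Y⁻¹ * X * Y * X :=
    PSL2.commute_of_fixed h2 hH hXH (H.mul_mem (H.mul_mem (H.inv_mem hYH) hXH) hYH) hXP hXY
  have ht : X.1.trace = (Y⁻¹ * X * Y).1.trace := by
    rw [mul_assoc, SL2.trace_mul_comm, mul_inv_cancel_right]
  have h4 : X.1.trace ^ 2 ≠ 4 := by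
    intro h
    exact hX ⟨0, by rw [h]; ring⟩
  have h10 := SL2.coeff_ne_zero_of_not_isSquare hX
  rcases SL2.eq_or_eq_inv_of_commute h2 hc ht h4 h10 with h | h
  · left
    rw [mul_assoc, inv_mul_eq_iff_eq_mul] at h
    exact h
  · right
    rw [mul_assoc, inv_mul_eq_iff_eq_mul] at h
    have h' := SL2.trace_mul_inv_add Y X
    rw [← h, SL2.trace_mul_comm Y X, hY, zero_mul, ← two_mul] at h'
    exact (mul_eq_zero.mp h').resolve_left h2

/-- The relation between an element of `PSL₂(p)` without eigenvectors and an involution that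
together generate a proper subgroup. -/
theorem PSL2.trace_mul_of_closure_ne_top (hp2 : p ≠ 2) (hn2 : ¬ IsSquare (2 : ZMod p))
    (hn5 : (5 : ZMod p) ≠ 0 → ¬ IsSquare (5 : ZMod p)) {X Y : SL(2, ZMod p)}
    (hX : ¬ IsSquare (X.1.trace ^ 2 - 4)) (hX2 : 2 < orderOf (X : PSL(2, ZMod p)))
    (hY2 : orderOf (Y : PSL(2, ZMod p)) = 2)
    (hXY : Subgroup.closure {(X : PSL(2, ZMod p)), (Y : PSL(2, ZMod p))} ≠ ⊤) :
    X * Y = Y * X ∨ (X * Y).1.trace = 0 ∨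
      orderOf (X : PSL(2, ZMod p)) = 3 ∧ (X * Y).1.trace ^ 2 = 1 := by
  have h2 : (2 : ZMod p) ≠ 0 := Ring.two_ne_zero (by rwa [ZMod.ringChar_zmod_n])
  have hX1 : (X : PSL(2, ZMod p)) ≠ 1 := by
    intro h
    simp [h] at hX2
  have hY1 : (Y : PSL(2, ZMod p)) ≠ 1 := by
    intro h
    simp [h] at hY2
  have hY : Y.1.trace = 0 := PSL2.trace_eq_zero_of_sq hY1 (orderOf_dvd_iff_pow_eq_one.mp hY2.dvd)
  set H := Subgroup.closure {(X : PSL(2, ZMod p)), (Y : PSL(2, ZMod p))} with hHdef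
  have hXH : (X : PSL(2, ZMod p)) ∈ H := Subgroup.subset_closure (by simp)
  have hYH : (Y : PSL(2, ZMod p)) ∈ H := Subgroup.subset_closure (by simp)
  have hH : ¬ p ∣ Nat.card H := fun h => hXY (PSL2.eq_top_of_dvd_card hXH hX h)
  let K := GaloisField p 2
  let _ : MulAction H (OnePoint K) :=
    MulAction.compHom (OnePoint K) ((PSL2.toPerm (ZMod p) K).comp H.subtype)
  have hfix : ∀ g : H, g ≠ 1 → (MulAction.fixedBy (OnePoint K) g).ncard = 2 := by
    intro g hg
    exact PSL2.ncard_fixed_points_of_mem hp2 hH g.2 (by simpa using hg)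
  have hFin : Finite (OnePoint K) := inferInstanceAs (Finite (Option K))
  have hle : ∀ g ∈ H, ∀ P : OnePoint K, PSL2.toPerm (ZMod p) K g P = P →
      orderOf g ≤ Nat.card (MulAction.stabilizer H P) := by
    intro g hg P hgP
    have : (⟨g, hg⟩ : H) ∈ MulAction.stabilizer H P := hgP
    have := Subgroup.orderOf_dvd_natCard _ this
    rw [Subgroup.orderOf_mk] at this
    exact Nat.le_of_dvd Nat.card_pos this
  rcases MulAction.stabilizer_cases_of_two_fixed_points hfix with ⟨P, hP⟩ | hd | h3 | ⟨P, hP⟩ |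
    ⟨P, hP⟩
  · exact .inl (PSL2.commute_of_fixed h2 hH hXH hYH (hP ⟨_, hXH⟩) (hP ⟨_, hYH⟩))
  · obtain ⟨P, P', hne, hPP'⟩ :=
      Set.ncard_eq_two.mp (hfix ⟨_, hXH⟩ (by rwa [ne_eq, Subgroup.mk_eq_one]))
    have hmem : ∀ Q, PSL2.toPerm (ZMod p) K X Q = Q ↔ Q = P ∨ Q = P' := by
      intro Q
      have : Q ∈ MulAction.fixedBy (OnePoint K) (⟨X, hXH⟩ : H) ↔ Q = P ∨ Q = P' := by
        rw [hPP']
        rfl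
      exact this
    have hstab : ∀ Q, Q = P ∨ Q = P' → 2 < Nat.card (MulAction.stabilizer H Q) := fun Q hQ =>
      hX2.trans_le (hle _ hXH Q ((hmem Q).mpr hQ))
    obtain ⟨hP', horb⟩ := hd P P' (hstab P (.inl rfl)) (hstab P' (.inr rfl))
    have horb' : MulAction.orbit H P = {P, P'} := by
      refine (Set.eq_of_subset_of_ncard_le ?_ ?_ ?_).symm
      · rintro Q (rfl | rfl)
        · exact MulAction.mem_orbit_self _
        · exact hP'
      · rw [horb, Set.ncard_pair hne]
      · exact Set.toFinite _
    have hYP : PSL2.toPerm (ZMod p) K Y P = P ∨ PSL2.toPerm (ZMod p) K Y P = P' := by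
      have : (⟨Y, hYH⟩ : H) • P ∈ MulAction.orbit H P := MulAction.mem_orbit _ _
      rw [horb'] at this
      exact this
    rw [← or_assoc]
    left
    refine PSL2.mul_comm_or_trace_mul_eq_zero h2 hH hX hY hXH hYH ((hmem P).mpr (.inl rfl)) ?_
    rw [map_mul, map_mul, Equiv.Perm.mul_apply, Equiv.Perm.mul_apply, (hmem _).mpr hYP,
      QuotientGroup.mk_inv, map_inv, Equiv.Perm.inv_eq_iff_eq]
  · right
    have hle3 : ∀ g ∈ H, g ≠ 1 → orderOf g ≤ 3 := by
      intro g hg hg1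
      obtain ⟨P, _, _, hP⟩ :=
        Set.ncard_eq_two.mp (hfix ⟨g, hg⟩ (by rwa [ne_eq, Subgroup.mk_eq_one]))
      refine (hle g hg P ?_).trans (h3 P)
      have : P ∈ MulAction.fixedBy (OnePoint K) (⟨g, hg⟩ : H) := by
        rw [hP]
        exact Set.mem_insert _ _
      exact this
    have hX3 := hle3 _ hXH hX1
    have hXY1 : ((X * Y : SL(2, ZMod p)) : PSL(2, ZMod p)) ≠ 1 := by
      intro h
      rw [QuotientGroup.mk_mul, mul_eq_one_iff_eq_inv] at h
      rw [h, orderOf_inv] at hX2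
      omega
    have h3' := hle3 _ (H.mul_mem hXH hYH) hXY1
    have hpos : 0 < orderOf ((X * Y : SL(2, ZMod p)) : PSL(2, ZMod p)) := orderOf_pos _
    have hone : orderOf ((X * Y : SL(2, ZMod p)) : PSL(2, ZMod p)) ≠ 1 := by
      rwa [ne_eq, orderOf_eq_one_iff]
    have hpow := pow_orderOf_eq_one ((X * Y : SL(2, ZMod p)) : PSL(2, ZMod p))
    obtain h | h : orderOf ((X * Y : SL(2, ZMod p)) : PSL(2, ZMod p)) = 2 ∨
        orderOf ((X * Y : SL(2, ZMod p)) : PSL(2, ZMod p)) = 3 := by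
      change orderOf ((X * Y : SL(2, ZMod p)) : PSL(2, ZMod p)) ≤ 3 at h3'
      omega
    · rw [h] at hpow
      exact .inl (PSL2.trace_eq_zero_of_sq hXY1 hpow)
    · rw [h] at hpow
      exact .inr ⟨by omega, PSL2.trace_sq_of_cube hXY1 hpow⟩
  · exact absurd (PSL2.isSquare_two_of_card_eq_four h2 hH (P := P) (fun g hg => hg) hP) hn2
  · have h5 : Nat.card (MulAction.stabilizer H P) ∣ Nat.card H := Subgroup.card_subgroup_dvd_card _
    refine absurd (PSL2.isSquare_five_of_card_eq_five hP) (hn5 ?_)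
    intro h
    have : ((5 : ℕ) : ZMod p) = 0 := by exact_mod_cast h
    rw [ZMod.natCast_eq_zero_iff] at this
    exact hH (this.trans (hP ▸ h5))

end Dickson

section Conics

variable {F : Type*} [Field F]

/-- The affine points of a conic `u ^ 2 - d * v ^ 2 = k` are parametrized by the slopes of the lines
through one of them. -/
lemma ncard_conic_le [Finite F] {d : F} (hd : ¬ IsSquare d) (k : F) :
    {q : F × F | q.1 ^ 2 - d * q.2 ^ 2 = k}.ncard ≤ Nat.card F + 1 := by
  have hd0 : d ≠ 0 := by
    rintro rfl
    exact hd ⟨0, by simp⟩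
  have hm : ∀ m : F, 1 - d * m ^ 2 ≠ 0 := by
    intro m h
    have hm0 : m ≠ 0 := by
      rintro rfl
      simp at h
    refine hd ⟨m⁻¹, ?_⟩
    field_simp
    linear_combination -h
  rcases Set.eq_empty_or_nonempty {q : F × F | q.1 ^ 2 - d * q.2 ^ 2 = k} with h | ⟨⟨a, b⟩, hab⟩
  · simp [h]
  let f : Option F → F × F := fun o => o.elim (a, -b) fun m =>
    (a + (2 * d * b * m - 2 * a) / (1 - d * m ^ 2),
      b + (2 * d * b * m - 2 * a) / (1 - d * m ^ 2) * m)
  have hf : {q : F × F | q.1 ^ 2 - d * q.2 ^ 2 = k} ⊆ Set.range f := by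
    rintro ⟨u, v⟩ huv
    change a ^ 2 - d * b ^ 2 = k at hab
    change u ^ 2 - d * v ^ 2 = k at huv
    by_cases hua : u = a
    · subst hua
      have h : (v - b) * (v + b) = 0 := by
        apply mul_left_cancel₀ hd0
        linear_combination hab - huv
      rcases mul_eq_zero.mp h with h | h
      · have hvb : v = b := sub_eq_zero.mp h
        subst hvb
        by_cases hv : v = 0
        · exact ⟨none, by simp [f, hv]⟩
        · refine ⟨some (u / (d * v)), ?_⟩
          have h0 : 2 * d * v * (u / (d * v)) - 2 * u = 0 := by
            field_simp
            ring
          simp [f, h0]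
      · exact ⟨none, by simp [f, eq_neg_of_add_eq_zero_left h]⟩
    · have hua' : u - a ≠ 0 := sub_ne_zero.mpr hua
      obtain ⟨m, hm'⟩ : ∃ m, v - b = m * (u - a) := ⟨(v - b) / (u - a), by field_simp⟩
      have hs : (2 * d * b * m - 2 * a) / (1 - d * m ^ 2) = u - a := by
        rw [div_eq_iff (hm m)]
        apply mul_left_cancel₀ hua'
        have hv : v = b + m * (u - a) := by linear_combination hm'
        subst hv
        linear_combination hab - huv
      refine ⟨some m, ?_⟩
      simp only [f, Option.elim_some, hs]
      ext1
      · ring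
      · linear_combination -hm'
  calc _ ≤ (Set.range f).ncard := Set.ncard_le_ncard hf (Set.toFinite _)
    _ ≤ Nat.card (Option F) := by
      rw [← Nat.card_coe_set_eq]
      exact Finite.card_range_le f
    _ = Nat.card F + 1 := Finite.card_option

/-- In `SL₂(q)` there are at most `q + 1` elements of trace zero whose product with a given element
without eigenvectors has a given trace. -/
lemma SL2.ncard_trace_mul_eq_le [Finite F] (h2 : (2 : F) ≠ 0) {X : SL(2, F)}
    (hX : ¬ IsSquare (X.1.trace ^ 2 - 4)) (t : F) :
    {Y : SL(2, F) | Y.1.trace = 0 ∧ (X * Y).1.trace = t}.ncard ≤ Nat.card F + 1 := by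
  have hdet := SL2.det_eq X
  have h10 := SL2.coeff_ne_zero_of_not_isSquare hX
  set D := X.1.trace ^ 2 - 4 with hD
  have hD0 : D ≠ 0 := by
    intro h
    exact hX ⟨0, by simp [h]⟩
  rw [Matrix.trace_fin_two] at hD
  obtain ⟨r, hr⟩ : ∃ r, D * r = 2 * X.1 1 0 * t := ⟨2 * X.1 1 0 * t / D, by field_simp⟩
  refine le_trans ?_ (ncard_conic_le hX (-4 * X.1 1 0 ^ 2 - D * r ^ 2))
  have htr : ∀ Y ∈ {Y : SL(2, F) | Y.1.trace = 0 ∧ (X * Y).1.trace = t}, Y.1 1 1 = -Y.1 0 0 ∧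
      (X.1 0 0 - X.1 1 1) * Y.1 0 0 + X.1 0 1 * Y.1 1 0 + X.1 1 0 * Y.1 0 1 = t := by
    rintro Y ⟨h0, h1⟩
    rw [Matrix.trace_fin_two] at h0
    rw [Matrix.SpecialLinearGroup.coe_mul, Matrix.trace_fin_two, Matrix.mul_apply, Matrix.mul_apply,
      Fin.sum_univ_two, Fin.sum_univ_two] at h1
    exact ⟨by linear_combination h0, by linear_combination h1 - X.1 1 1 * h0⟩
  refine Set.ncard_le_ncard_of_injOn
    (fun Y => (2 * X.1 1 0 * Y.1 0 0 - (X.1 0 0 - X.1 1 1) * Y.1 1 0, Y.1 1 0 - r)) ?_ ?_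
    (Set.toFinite _)
  · intro Y hY
    have hdY := SL2.det_eq Y
    obtain ⟨h0, h1⟩ := htr Y hY
    rw [h0] at hdY
    change (2 * X.1 1 0 * Y.1 0 0 - (X.1 0 0 - X.1 1 1) * Y.1 1 0) ^ 2 - D * (Y.1 1 0 - r) ^ 2 = _
    linear_combination -4 * X.1 1 0 ^ 2 * hdY + 2 * Y.1 1 0 * hr - 4 * X.1 1 0 * Y.1 1 0 * h1 -
      4 * Y.1 1 0 ^ 2 * hdet - Y.1 1 0 ^ 2 * hD
  · intro Y hY Z hZ hYZ
    obtain ⟨hY0, hY1⟩ := htr Y hY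
    obtain ⟨hZ0, hZ1⟩ := htr Z hZ
    obtain ⟨hu, hw⟩ := Prod.mk.inj hYZ
    have e10 : Y.1 1 0 = Z.1 1 0 := by linear_combination hw
    have e00 : Y.1 0 0 = Z.1 0 0 := by
      apply mul_left_cancel₀ (mul_ne_zero h2 h10)
      linear_combination hu + (X.1 0 0 - X.1 1 1) * e10
    have e01 : Y.1 0 1 = Z.1 0 1 := by
      apply mul_left_cancel₀ h10
      linear_combination hY1 - hZ1 - (X.1 0 0 - X.1 1 1) * e00 - X.1 0 1 * e10
    refine Subtype.ext (Matrix.ext fun i j => ?_)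
    fin_cases i <;> fin_cases j
    · exact e00
    · exact e01
    · exact e10
    · exact hY0.trans ((congrArg _ e00).trans hZ0.symm)

end Conics

section Involutions

variable {p : ℕ} [Fact p.Prime]

lemma PSL2.two_mul_ncard_le_ncard_preimage (h2 : (2 : ZMod p) ≠ 0) (B : Set PSL(2, ZMod p)) :
    2 * B.ncard ≤ {Y : SL(2, ZMod p) | (Y : PSL(2, ZMod p)) ∈ B}.ncard := by
  have e := QuotientGroup.preimageMkEquivSubgroupProdSet (Subgroup.center SL(2, ZMod p)) B
  have h := Nat.card_congr e
  rw [Nat.card_prod, Nat.card_coe_set_eq, Nat.card_coe_set_eq] at h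
  refine le_trans (Nat.mul_le_mul_right _ ?_) h.ge
  have : Nontrivial (Subgroup.center SL(2, ZMod p)) := by
    refine ⟨1, ⟨-1, SL2.mem_center_iff.mpr (.inr rfl)⟩, ?_⟩
    intro h
    have h10 := congrArg (fun k : Subgroup.center SL(2, ZMod p) => k.1.1 0 0) h
    simp at h10
    exact h2 (by linear_combination h10)
  exact Finite.one_lt_card

lemma SL2.ncard_commute_le (h2 : (2 : ZMod p) ≠ 0) {X : SL(2, ZMod p)} (h10 : X.1 1 0 ≠ 0) :
    {Y : SL(2, ZMod p) | Y.1.trace = 0 ∧ X * Y = Y * X}.ncard ≤ 2 := by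
  rcases Set.eq_empty_or_nonempty {Y : SL(2, ZMod p) | Y.1.trace = 0 ∧ X * Y = Y * X} with
    h | ⟨Y, hY0, hY⟩
  · simp [h]
  refine (Set.ncard_le_ncard (t := {Y, -Y}) ?_ (Set.toFinite _)).trans
    ((Set.ncard_insert_le _ _).trans (by simp))
  rintro Z ⟨hZ0, hZ⟩
  refine PSL2.mk_eq_mk_iff.mp (PSL2.eq_of_commute_of_trace_eq_zero h2 ?_ hZ0 hY0)
  have entries : ∀ W : SL(2, ZMod p), W.1.trace = 0 → X * W = W * X →
      W.1 1 1 = -W.1 0 0 ∧ X.1 1 0 * W.1 0 1 = X.1 0 1 * W.1 1 0 ∧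
        2 * X.1 1 0 * W.1 0 0 = (X.1 0 0 - X.1 1 1) * W.1 1 0 := by
    intro W hW0 hW
    have hW' : X.1 * W.1 = W.1 * X.1 := congrArg Subtype.val hW
    have e00 := congrFun (congrFun hW' 0) 0
    have e10 := congrFun (congrFun hW' 1) 0
    simp only [Matrix.mul_apply, Fin.sum_univ_two] at e00 e10
    rw [Matrix.trace_fin_two] at hW0
    exact ⟨by linear_combination hW0, by linear_combination -e00,
      by linear_combination e10 + X.1 1 0 * hW0⟩
  obtain ⟨hy, hy1, hy2⟩ := entries Y hY0 hY
  obtain ⟨hz, hz1, hz2⟩ := entries Z hZ0 hZ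
  have h210 := mul_ne_zero h2 h10
  have e1 : Z.1 0 1 * Y.1 1 0 = Y.1 0 1 * Z.1 1 0 := by
    apply mul_left_cancel₀ h10
    linear_combination Y.1 1 0 * hz1 - Z.1 1 0 * hy1
  have e2 : Z.1 0 0 * Y.1 1 0 = Y.1 0 0 * Z.1 1 0 := by
    apply mul_left_cancel₀ h210
    linear_combination Y.1 1 0 * hz2 - Z.1 1 0 * hy2
  have e3 : Z.1 0 0 * Y.1 0 1 = Y.1 0 0 * Z.1 0 1 := by
    apply mul_left_cancel₀ (mul_ne_zero h210 h10)
    linear_combination X.1 1 0 * Y.1 0 1 * hz2 - X.1 1 0 * Z.1 0 1 * hy2 -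
      (X.1 0 0 - X.1 1 1) * X.1 1 0 * e1
  refine Subtype.ext ?_
  change Z.1 * Y.1 = Y.1 * Z.1
  ext i j
  fin_cases i <;> fin_cases j <;> simp [Matrix.mul_apply, hy, hz]
  · linear_combination e1
  · linear_combination 2 * e3
  · linear_combination -2 * e2
  · linear_combination -e1

end Involutions

theorem coclique_bound_main1a (p : ℕ) (hp : p.Prime) (hp2 : 2 < p)
    (A : Set PSL(2, ZMod p)) (hA : IsMaximalCoclique A)
    (hnotmax : ∀ M : Subgroup PSL(2, ZMod p), IsCoatom M → A ≠ (M : Set PSL(2, ZMod p)))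
    (x : PSL(2, ZMod p)) (hxA : x ∈ A) (hx2 : 2 < orderOf x)
    (hinv : ∀ y ∈ A, y ∉ Subgroup.zpowers x → orderOf y = 2)
    (hxdvd : orderOf x ∣ p + 1)
    (hA4 : HasMaximalSubgroupIsoTo PSL(2, ZMod p) (alternatingGroup (Fin 4))) :
    2 * A.ncard ≤ 3 * (p + 1) + 8 := by
  have : Fact p.Prime := ⟨hp⟩
  obtain ⟨M, hM, ⟨e⟩⟩ := hA4
  have hp2' : p ≠ 2 := hp2.ne'
  have h2 : (2 : ZMod p) ≠ 0 := Ring.two_ne_zero (by rwa [ZMod.ringChar_zmod_n])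
  obtain ⟨X, rfl⟩ := QuotientGroup.mk_surjective x
  have hX := PSL2.not_isSquare_of_orderOf_dvd h2 hx2 hxdvd
  have h10 := SL2.coeff_ne_zero_of_not_isSquare hX
  set n := orderOf (X : PSL(2, ZMod p))
  let Z : Set PSL(2, ZMod p) := {g | g ∈ Subgroup.zpowers (X : PSL(2, ZMod p))}
  have hZcard : Z.ncard = n := by
    rw [← Nat.card_coe_set_eq]
    exact Nat.card_zpowers _
  have hAcard : A.ncard ≤ n + (A \ Z).ncard := by
    rw [← hZcard]
    refine (Set.ncard_le_ncard ?_ (Set.toFinite _)).trans (Set.ncard_union_le _ _)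
    rw [Set.union_sdiff_self]
    exact Set.subset_union_right
  let C : Set SL(2, ZMod p) := {Y | Y.1.trace = 0 ∧ X * Y = Y * X}
  let T : ZMod p → Set SL(2, ZMod p) := fun t => {Y | Y.1.trace = 0 ∧ (X * Y).1.trace = t}
  have hC : C.ncard ≤ 2 := SL2.ncard_commute_le h2 h10
  have hT : ∀ t, (T t).ncard ≤ p + 1 := fun t =>
    (SL2.ncard_trace_mul_eq_le h2 hX t).trans_eq (by rw [Nat.card_zmod])
  have hpre := PSL2.two_mul_ncard_le_ncard_preimage h2 (A \ Z)
  have key : ∀ Y : SL(2, ZMod p), (Y : PSL(2, ZMod p)) ∈ A \ Z → Y.1.trace = 0 ∧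
      (X * Y = Y * X ∨ (X * Y).1.trace = 0 ∨ n = 3 ∧ (X * Y).1.trace ^ 2 = 1) := by
    rintro Y ⟨hYA, hYZ⟩
    have hY2 := hinv _ hYA hYZ
    refine ⟨PSL2.trace_eq_zero_of_sq ?_ (orderOf_dvd_iff_pow_eq_one.mp hY2.dvd), ?_⟩
    · intro h
      simp [h] at hY2
    · exact PSL2.trace_mul_of_closure_ne_top hp2' (PSL2.not_isSquare_two h2 hM e)
        (fun h5 => PSL2.not_isSquare_five h2 h5 hM e) hX hx2 hY2 (hA.1 _ hxA _ hYA)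
  by_cases h3 : n = 3
  · have hsub : {Y : SL(2, ZMod p) | (Y : PSL(2, ZMod p)) ∈ A \ Z} ⊆
        C ∪ (T 0 ∪ (T 1 ∪ T (-1))) := by
      intro Y hY
      obtain ⟨h0, h | h | ⟨-, h⟩⟩ := key Y hY
      · exact .inl ⟨h0, h⟩
      · exact .inr (.inl ⟨h0, h⟩)
      · rcases sq_eq_one_iff.mp h with h | h
        · exact .inr (.inr (.inl ⟨h0, h⟩))
        · exact .inr (.inr (.inr ⟨h0, h⟩))
    have h := Set.ncard_le_ncard hsub (Set.toFinite _)
    have hu := Set.ncard_union_le C (T 0 ∪ (T 1 ∪ T (-1)))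
    have hu' := Set.ncard_union_le (T 0) (T 1 ∪ T (-1))
    have hu'' := Set.ncard_union_le (T 1) (T (-1))
    have := hT 0
    have := hT 1
    have := hT (-1)
    omega
  · have hsub : {Y : SL(2, ZMod p) | (Y : PSL(2, ZMod p)) ∈ A \ Z} ⊆ C ∪ T 0 := by
      intro Y hY
      obtain ⟨h0, h | h | ⟨h, -⟩⟩ := key Y hY
      · exact .inl ⟨h0, h⟩
      · exact .inr ⟨h0, h⟩
      · exact absurd h h3
    have h := Set.ncard_le_ncard hsub (Set.toFinite _)
    have hu := Set.ncard_union_le C (T 0)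
    have hnle := Nat.le_of_dvd (by omega) hxdvd
    have := hT 0
    omega
end

section
/- Let p > 2 be a prime, G = PSL₂(p), and let A ⊆ G be a maximal coclique which is not the underlying set of a maximal subgroup of G. Suppose A contains an element x of order greater than 2 such that every element of A not lying in the cyclic subgroup ⟨x⟩ has order 2. If the order of x divides p + 1 and G contains A₅ or S₄ (or both) as a maximal subgroup, then |A| ≤ (17/2)(p + 1) + 4, i.e. 2·|A| ≤ 17(p + 1) + 8. -/
open scoped MatrixGroups

section Counting

open MulAction Finset

variable {G X : Type*} [Group G] [MulAction G X]

theorem card_stabilizer_eq_of_mem_orbit {v w : X} (h : w ∈ orbit G v) :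
    Nat.card (stabilizer G w) = Nat.card (stabilizer G v) :=
  Nat.card_congr (stabilizerEquivStabilizerOfOrbitRel h).toEquiv

variable [Fintype X]

open Classical in
/-- The orbit of a point, as a finset. -/
noncomputable def orbitFinset (G : Type*) {X : Type*} [Group G] [MulAction G X] [Fintype X]
    (v : X) : Finset X := univ.filter (· ∈ orbit G v)

theorem mem_orbitFinset {v w : X} : w ∈ orbitFinset G v ↔ w ∈ orbit G v := by
  simp [orbitFinset]

theorem disjoint_orbitFinset {v w : X} (h : w ∉ orbit G v) :
    Disjoint (orbitFinset G v) (orbitFinset G w) := by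
  rw [Finset.disjoint_left]
  intro a ha hb
  rw [mem_orbitFinset] at ha hb
  apply h
  rw [← orbit_eq_iff.2 ha, ← mem_orbit_symm]
  exact hb

variable [Fintype G]

open Classical in
theorem sum_card_stabilizer_eq_sum_card_fixedBy :
    ∑ v : X, Nat.card (stabilizer G v) = ∑ g : G, Nat.card (fixedBy X g) := by
  have h := Finset.sum_card_bipartiteAbove_eq_sum_card_bipartiteBelow
    (s := (univ : Finset X)) (t := (univ : Finset G)) (fun v g => g • v = v)
  convert h using 2 with v _ g _
  · rw [Nat.card_eq_fintype_card, Fintype.card_subtype]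
    simp [bipartiteAbove, mem_stabilizer_iff]
  · rw [Nat.card_eq_fintype_card, Fintype.card_subtype]
    simp [bipartiteBelow, mem_fixedBy]

theorem card_orbitFinset_mul (v : X) :
    (orbitFinset G v).card * Nat.card (stabilizer G v) = Nat.card G := by
  classical
  rw [orbitFinset, ← Fintype.card_subtype, Nat.card_eq_fintype_card, Nat.card_eq_fintype_card]
  exact card_orbit_mul_card_stabilizer_eq_card_group G v

theorem sum_orbitFinset (v : X) :
    ∑ w ∈ orbitFinset G v, ((Nat.card (stabilizer G w) : ℤ) - 2) =
      Nat.card G - 2 * (orbitFinset G v).card := by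
  rw [Finset.sum_congr rfl (g := fun _ => (Nat.card (stabilizer G v) : ℤ) - 2)
    (fun w hw => by rw [card_stabilizer_eq_of_mem_orbit (mem_orbitFinset.1 hw)]),
    Finset.sum_const, ← card_orbitFinset_mul (G := G) v, nsmul_eq_mul]
  push_cast
  ring

open Classical in
theorem sum_card_stabilizer_sub_two {Z : Subgroup G} (hZ2 : Nat.card Z = 2)
    (hZ : ∀ g ∈ Z, ∀ v : X, g • v = v) (hfix : ∀ g ∉ Z, Nat.card (fixedBy X g) = 2) :
    ∑ v : X, ((Nat.card (stabilizer G v) : ℤ) - 2) = 2 * Nat.card G - 4 := by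
  have h1 : ∀ g : G, Nat.card (fixedBy X g) =
      2 + if g ∈ Z then (Nat.card (fixedBy X g) - 2 : ℤ) else 0 := by
    intro g
    split_ifs with hg
    · ring
    · rw [hfix g hg]; rfl
  have h2 : ∀ g ∈ Z, (Nat.card (fixedBy X g) - 2 : ℤ) = Fintype.card X - 2 := by
    intro g hg
    rw [show fixedBy X g = Set.univ from Set.eq_univ_of_forall (hZ g hg)]
    simp
  have h3 := congrArg (Nat.cast : ℕ → ℤ) (sum_card_stabilizer_eq_sum_card_fixedBy (G := G) (X := X))
  push_cast at h3
  rw [Finset.sum_sub_distrib, h3, Finset.sum_congr rfl (fun g _ => h1 g), Finset.sum_add_distrib,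
    ← Finset.sum_filter, Finset.sum_congr rfl (fun g hg => h2 g (Finset.mem_filter.1 hg).2)]
  have hc : (univ.filter (· ∈ Z)).card = 2 := by
    rw [← Fintype.card_subtype, ← Nat.card_eq_fintype_card]; exact hZ2
  simp [hc]
  ring

/-- Let `Z` be a subgroup of order two acting trivially on `X`, such that every element outside `Z`
has exactly two fixed points. Then a point whose stabilizer has order at least `12` is fixed by
every `x` with `x ^ 4 ≠ 1`. -/
theorem smul_eq_of_twelve_le_card_stabilizer {Z : Subgroup G} (hZ2 : Nat.card Z = 2)
    (hZ : ∀ g ∈ Z, ∀ v : X, g • v = v) (hfix : ∀ g ∉ Z, Nat.card (fixedBy X g) = 2)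
    {v : X} (hv : 12 ≤ Nat.card (stabilizer G v)) {x : G} (hx : x ^ 4 ≠ 1) : x • v = v := by
  classical
  by_contra hxv
  have htotal := sum_card_stabilizer_sub_two hZ2 hZ hfix
  have heven : ∀ w : X, 2 ∣ Nat.card (stabilizer G w) := fun w =>
    hZ2 ▸ Subgroup.card_dvd_of_le (fun g hg => hZ g hg w)
  have hpos : ∀ w : X, 0 < Nat.card (stabilizer G w) := fun w => Nat.card_pos
  have hnonneg : ∀ w : X, (0 : ℤ) ≤ (Nat.card (stabilizer G w) : ℤ) - 2 := fun w => by
    have := heven w; have := hpos w; omega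
  have hexists : ∀ S : Finset X,
      ∑ w ∈ S, ((Nat.card (stabilizer G w) : ℤ) - 2) < 2 * Nat.card G - 4 →
      ∃ w ∉ S, 4 ≤ Nat.card (stabilizer G w) := by
    intro S hS
    by_contra! hcon
    rw [← htotal, ← Finset.sum_subset (Finset.subset_univ S)] at hS
    · exact lt_irrefl _ hS
    · intro w _ hw
      have := hcon w hw; have := heven w; have := hpos w; omega
  have hle : ∀ S : Finset X,
      ∑ w ∈ S, ((Nat.card (stabilizer G w) : ℤ) - 2) ≤ 2 * Nat.card G - 4 := fun S =>
    htotal ▸ Finset.sum_le_sum_of_subset_of_nonneg (Finset.subset_univ S) fun w _ _ => hnonneg w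
  have hbound : ∀ (w : X) (n : ℕ), n ≤ Nat.card (stabilizer G w) →
      (orbitFinset G w).card * n ≤ Nat.card G := fun w n hn => by
    rw [← card_orbitFinset_mul w]; exact Nat.mul_le_mul_left _ hn
  have hself : ∀ w : X, w ∈ orbitFinset G w := fun w => mem_orbitFinset.2 (mem_orbit_self w)
  have hkpos : ∀ w : X, 0 < (orbitFinset G w).card := fun w => Finset.card_pos.2 ⟨w, hself w⟩
  have hxZ : x ∉ Z := fun h => hx <| by
    have h2 : x ^ 2 = 1 := by
      have := pow_card_eq_one' (x := (⟨x, h⟩ : Z))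
      rw [hZ2] at this
      simpa using congrArg Subtype.val this
    rw [show 4 = 2 * 2 from rfl, pow_mul, h2, one_pow]
  obtain ⟨v₀, hv₀⟩ : ∃ v₀ : X, x • v₀ = v₀ := by
    have : 0 < Nat.card (fixedBy X x) := by rw [hfix x hxZ]; norm_num
    obtain ⟨⟨⟨v₀, h⟩⟩, _⟩ := Nat.card_pos_iff.1 this
    exact ⟨v₀, h⟩
  have hE₀ : 6 ≤ Nat.card (stabilizer G v₀) := by
    by_contra! hlt
    have hd : Nat.card (stabilizer G v₀) ∣ 4 := by
      have h1 := heven v₀; have h2 := hpos v₀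
      generalize Nat.card (stabilizer G v₀) = m at *
      interval_cases m <;> omega
    apply hx
    have h1 := pow_card_eq_one' (x := (⟨x, hv₀⟩ : stabilizer G v₀))
    obtain ⟨c, hc⟩ := hd
    rw [hc, pow_mul]
    have h2 : x ^ Nat.card (stabilizer G v₀) = 1 := by simpa using congrArg Subtype.val h1
    rw [h2, one_pow]
  have hbv := hbound v 12 hv
  by_cases hmem : v₀ ∈ orbit G v
  · have hk : 3 ≤ (orbitFinset G v).card := by
      have hsub : ({v₀, v, x • v} : Finset X) ⊆ orbitFinset G v := by
        intro w hw
        simp only [Finset.mem_insert, Finset.mem_singleton] at hw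
        rcases hw with rfl | rfl | rfl
        · exact mem_orbitFinset.2 hmem
        · exact hself w
        · exact mem_orbitFinset.2 (mem_orbit v x)
      have hne : v₀ ≠ v := fun h => hxv (h ▸ hv₀)
      have hne' : v₀ ≠ x • v := fun h => hne (MulAction.injective x (hv₀.trans h))
      rw [← Finset.card_eq_three.2 ⟨v₀, v, x • v, hne, hne', fun h => hxv h.symm, rfl⟩]
      exact Finset.card_le_card hsub
    obtain ⟨v₂, hv₂, hE₂⟩ := hexists (orbitFinset G v) (by rw [sum_orbitFinset]; omega)
    rw [mem_orbitFinset] at hv₂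
    have hd₂ := disjoint_orbitFinset hv₂
    have hk₂ := hkpos v₂
    have hb₂ := hbound v₂ 4 hE₂
    obtain ⟨v₃, hv₃, hE₃⟩ := hexists (orbitFinset G v ∪ orbitFinset G v₂) (by
      rw [Finset.sum_union hd₂, sum_orbitFinset, sum_orbitFinset]; omega)
    simp only [Finset.mem_union, mem_orbitFinset, not_or] at hv₃
    have hd₃ : Disjoint (orbitFinset G v ∪ orbitFinset G v₂) (orbitFinset G v₃) :=
      Finset.disjoint_union_left.2 ⟨disjoint_orbitFinset hv₃.1, disjoint_orbitFinset hv₃.2⟩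
    have hk₃ := hkpos v₃
    have hb₃ := hbound v₃ 4 hE₃
    have hle₃ := hle ((orbitFinset G v ∪ orbitFinset G v₂) ∪ orbitFinset G v₃)
    have hs₃ : ∑ w ∈ (orbitFinset G v ∪ orbitFinset G v₂) ∪ orbitFinset G v₃,
        ((Nat.card (stabilizer G w) : ℤ) - 2) =
        (Nat.card G - 2 * (orbitFinset G v).card) + (Nat.card G - 2 * (orbitFinset G v₂).card) +
        (Nat.card G - 2 * (orbitFinset G v₃).card) := by
      rw [Finset.sum_union hd₃, Finset.sum_union hd₂, sum_orbitFinset, sum_orbitFinset,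
        sum_orbitFinset]
    rw [hs₃] at hle₃
    have hE₂' : Nat.card (stabilizer G v₂) = 4 := by
      by_contra hne
      have := hbound v₂ 6 (by have := heven v₂; omega)
      omega
    have hE₃' : Nat.card (stabilizer G v₃) = 4 := by
      by_contra hne
      have := hbound v₃ 6 (by have := heven v₃; omega)
      omega
    have hc₂ := card_orbitFinset_mul (G := G) v₂
    have hc₃ := card_orbitFinset_mul (G := G) v₃
    rw [hE₂'] at hc₂
    rw [hE₃'] at hc₃
    obtain ⟨v₄, hv₄, hE₄⟩ :=
      hexists ((orbitFinset G v ∪ orbitFinset G v₂) ∪ orbitFinset G v₃) (by rw [hs₃]; omega)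
    simp only [Finset.mem_union, mem_orbitFinset, not_or] at hv₄
    have hd₄ : Disjoint ((orbitFinset G v ∪ orbitFinset G v₂) ∪ orbitFinset G v₃)
        (orbitFinset G v₄) :=
      Finset.disjoint_union_left.2 ⟨Finset.disjoint_union_left.2
        ⟨disjoint_orbitFinset hv₄.1.1, disjoint_orbitFinset hv₄.1.2⟩, disjoint_orbitFinset hv₄.2⟩
    have hb₄ := hbound v₄ 4 hE₄
    have hle₄ := hle (((orbitFinset G v ∪ orbitFinset G v₂) ∪ orbitFinset G v₃) ∪
      orbitFinset G v₄)
    rw [Finset.sum_union hd₄, hs₃, sum_orbitFinset] at hle₄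
    omega
  · have hk : 2 ≤ (orbitFinset G v).card := by
      rw [← Finset.card_pair hxv]
      apply Finset.card_le_card
      intro w hw
      simp only [Finset.mem_insert, Finset.mem_singleton] at hw
      rcases hw with rfl | rfl
      · exact mem_orbitFinset.2 (mem_orbit v x)
      · exact hself w
    have hk₀ := hkpos v₀
    have hd₀ := disjoint_orbitFinset hmem
    have hb₀ := hbound v₀ 6 hE₀
    obtain ⟨v₂, hv₂, hE₂⟩ := hexists (orbitFinset G v ∪ orbitFinset G v₀) (by
      rw [Finset.sum_union hd₀, sum_orbitFinset, sum_orbitFinset]; omega)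
    simp only [Finset.mem_union, mem_orbitFinset, not_or] at hv₂
    have hd₂ : Disjoint (orbitFinset G v ∪ orbitFinset G v₀) (orbitFinset G v₂) :=
      Finset.disjoint_union_left.2 ⟨disjoint_orbitFinset hv₂.1, disjoint_orbitFinset hv₂.2⟩
    have hb₂ := hbound v₂ 4 hE₂
    have hle₂ := hle ((orbitFinset G v ∪ orbitFinset G v₀) ∪ orbitFinset G v₂)
    rw [Finset.sum_union hd₂, Finset.sum_union hd₀, sum_orbitFinset, sum_orbitFinset,
      sum_orbitFinset] at hle₂
    omega

end Counting

section SpecialLinearTwo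

open Matrix Subgroup

variable {F : Type*} [Field F]

theorem coe_sq_eq_trace_smul_sub_one (g : SL(2, F)) :
    (g : Matrix (Fin 2) (Fin 2) F) ^ 2 = (g : Matrix (Fin 2) (Fin 2) F).trace • g.1 - 1 := by
  have h := g.det_coe
  rw [det_fin_two] at h
  ext i j
  fin_cases i <;> fin_cases j <;>
    simp [sq, Matrix.mul_apply, trace_fin_two] <;> grind

theorem trace_sq (g : SL(2, F)) :
    ((g ^ 2 : SL(2, F)) : Matrix (Fin 2) (Fin 2) F).trace =
      (g : Matrix (Fin 2) (Fin 2) F).trace ^ 2 - 2 := by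
  rw [Matrix.SpecialLinearGroup.coe_pow, coe_sq_eq_trace_smul_sub_one]
  simp [trace_sub, trace_smul]
  ring

theorem mem_center_iff_eq_one_or_neg_one {g : SL(2, F)} :
    g ∈ center SL(2, F) ↔ g = 1 ∨ g = -1 := by
  rw [Matrix.SpecialLinearGroup.mem_center_iff]
  constructor
  · rintro ⟨r, hr, hg⟩
    rw [Fintype.card_fin, sq_eq_one_iff] at hr
    rcases hr with rfl | rfl
    · left; apply Subtype.ext; simp [← hg]
    · right; apply Subtype.ext; rw [Matrix.SpecialLinearGroup.coe_neg, ← hg, map_neg, map_one]; simp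
  · rintro (rfl | rfl)
    · exact ⟨1, by simp⟩
    · exact ⟨-1, by simp, by rw [map_neg, map_one]; simp⟩

theorem mem_center_of_smul_eq {g : SL(2, F)} {a b : F} (ha : a ≠ 0)
    (h : a • (g : Matrix (Fin 2) (Fin 2) F) = b • 1) : g ∈ center SL(2, F) := by
  have hg : (g : Matrix (Fin 2) (Fin 2) F) = (a⁻¹ * b) • 1 := by
    rw [mul_smul, ← h, smul_smul, inv_mul_cancel₀ ha, one_smul]
  rw [Matrix.SpecialLinearGroup.mem_center_iff]
  refine ⟨a⁻¹ * b, ?_, ?_⟩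
  · have := g.det_coe
    rwa [hg, det_smul, det_one, mul_one] at this
  · rw [hg, smul_one_eq_diagonal]; rfl

theorem trace_eq_zero_of_sq_mem_center {g : SL(2, F)} (h : g ^ 2 ∈ center SL(2, F))
    (hg : g ∉ center SL(2, F)) : (g : Matrix (Fin 2) (Fin 2) F).trace = 0 := by
  by_contra ht
  apply hg
  have hsq := coe_sq_eq_trace_smul_sub_one g
  rw [← Matrix.SpecialLinearGroup.coe_pow] at hsq
  rcases mem_center_iff_eq_one_or_neg_one.1 h with h1 | h1 <;> rw [h1] at hsq
  · refine mem_center_of_smul_eq (b := 2) ht ?_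
    rw [two_smul, ← sub_eq_iff_eq_add, ← hsq]; simp
  · refine mem_center_of_smul_eq (b := 0) ht ?_
    rw [Matrix.SpecialLinearGroup.coe_neg, Matrix.SpecialLinearGroup.coe_one] at hsq
    rw [zero_smul, sub_eq_iff_eq_add.1 hsq.symm, neg_add_cancel]

theorem mem_center_of_sq_eq_one (h2 : (2 : F) ≠ 0) {g : SL(2, F)} (h : g ^ 2 = 1) :
    g ∈ center SL(2, F) := by
  by_contra hg
  have ht := trace_eq_zero_of_sq_mem_center (h ▸ one_mem _) hg
  have := trace_sq g
  rw [h, ht] at this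
  rw [Matrix.SpecialLinearGroup.coe_one, trace_one, Fintype.card_fin] at this
  exact h2 (mul_self_eq_zero.1 (by push_cast at this; linear_combination this))

theorem sq_eq_neg_one_of_trace_eq_zero {g : SL(2, F)}
    (h : (g : Matrix (Fin 2) (Fin 2) F).trace = 0) : g ^ 2 = -1 := by
  apply Subtype.ext
  rw [Matrix.SpecialLinearGroup.coe_pow, coe_sq_eq_trace_smul_sub_one, h]
  simp

theorem one_ne_neg_one (h2 : (2 : F) ≠ 0) : (1 : SL(2, F)) ≠ -1 := fun h => h2 <| by
  have := congrArg (fun g : SL(2, F) => (g : Matrix (Fin 2) (Fin 2) F) 0 0) h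
  simp at this
  linear_combination this

theorem card_center_eq_two (h2 : (2 : F) ≠ 0) : Nat.card (center SL(2, F)) = 2 := by
  have : (center SL(2, F) : Set SL(2, F)) = {1, -1} := by
    ext g
    simpa using mem_center_iff_eq_one_or_neg_one
  rw [← SetLike.coe_sort_coe, this, Nat.card_coe_set_eq, Set.ncard_pair (one_ne_neg_one h2)]

/-- The trace of a non-central element of order dividing an even number below `12`. -/
theorem trace_root_of_pow_eq_one (h2 : (2 : F) ≠ 0) {g : SL(2, F)} (hg : g ∉ center SL(2, F))
    {n : ℕ} (hn : Even n) (hpos : 0 < n) (hlt : n < 12) (h : g ^ n = 1) :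
    let s := (g : Matrix (Fin 2) (Fin 2) F).trace
    s * (s ^ 2 - 1) * (s ^ 2 - 2) * (s ^ 4 - 3 * s ^ 2 + 1) = 0 := by
  intro s
  obtain ⟨e, rfl⟩ := hn
  have hc : g ^ e ∈ center SL(2, F) :=
    mem_center_of_sq_eq_one h2 (by rw [← pow_mul, mul_two]; exact h)
  obtain ⟨ε, -, hε⟩ := Matrix.SpecialLinearGroup.mem_center_iff.1 hc
  have key : ∀ a b : F, (g : Matrix (Fin 2) (Fin 2) F) ^ e = a • g.1 + b • 1 → a = 0 := by
    intro a b hab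
    by_contra ha
    refine hg (mem_center_of_smul_eq (b := ε - b) ha ?_)
    rw [← Matrix.SpecialLinearGroup.coe_pow, ← hε] at hab
    rw [sub_smul, eq_sub_iff_add_eq, ← hab, smul_one_eq_diagonal]; rfl
  have p2 : (g : Matrix (Fin 2) (Fin 2) F) ^ 2 = s • g.1 + (-1 : F) • 1 := by
    rw [coe_sq_eq_trace_smul_sub_one, neg_one_smul, sub_eq_add_neg]
  have step : ∀ (k : ℕ) (a b : F), (g : Matrix (Fin 2) (Fin 2) F) ^ k = a • g.1 + b • 1 →
      (g : Matrix (Fin 2) (Fin 2) F) ^ (k + 1) = (a * s + b) • g.1 + (-a) • 1 := by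
    intro k a b hk
    rw [pow_succ, hk, add_mul, smul_mul_assoc, ← sq, p2]
    simp only [smul_mul_assoc, one_mul]
    module
  have p3 := step 2 _ _ p2
  have p4 := step 3 _ _ p3
  have p5 := step 4 _ _ p4
  have he : e < 6 := by omega
  have he0 : 0 < e := by omega
  interval_cases e
  · exact absurd (by simpa using hc) hg
  · have := key _ _ p2
    rw [this]; ring
  · have := key _ _ p3
    rw [show s ^ 2 - 1 = 0 by linear_combination this]; ring
  · have := key _ _ p4
    linear_combination (s ^ 2 - 1) * (s ^ 4 - 3 * s ^ 2 + 1) * this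
  · have := key _ _ p5
    linear_combination s * (s ^ 2 - 1) * (s ^ 2 - 2) * this

theorem trace_mul_sq_of_commute {x y : SL(2, F)} (h : Commute x y)
    (hy : (y : Matrix (Fin 2) (Fin 2) F).trace = 0) :
    ((x * y : SL(2, F)) : Matrix (Fin 2) (Fin 2) F).trace ^ 2 =
      4 - (x : Matrix (Fin 2) (Fin 2) F).trace ^ 2 := by
  have h1 := trace_sq (x * y)
  rw [h.mul_pow, sq_eq_neg_one_of_trace_eq_zero hy, mul_neg_one, Matrix.SpecialLinearGroup.coe_neg,
    trace_neg, trace_sq] at h1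
  linear_combination -h1

/-- Commuting trace-zero matrices are proportional. -/
theorem exists_eq_smul_of_commute (h2 : (2 : F) ≠ 0) {v w : Matrix (Fin 2) (Fin 2) F}
    (hv : v.trace = 0) (hw : w.trace = 0) (hw0 : w ≠ 0) (h : v * w = w * v) :
    ∃ c : F, v = c • w := by
  rw [trace_fin_two] at hv hw
  have hv' : v 1 1 = -v 0 0 := by linear_combination hv
  have hw' : w 1 1 = -w 0 0 := by linear_combination hw
  have e00 := congrFun (congrFun h 0) 0
  have e01 := congrFun (congrFun h 0) 1
  have e10 := congrFun (congrFun h 1) 0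
  simp only [Matrix.mul_apply, Fin.sum_univ_two, hv', hw'] at e00 e01 e10
  have f1 : v 0 1 * w 1 0 = w 0 1 * v 1 0 := by linear_combination e00
  have f2 : v 0 0 * w 0 1 = w 0 0 * v 0 1 :=
    mul_left_cancel₀ h2 (by linear_combination e01)
  have f3 : v 0 0 * w 1 0 = w 0 0 * v 1 0 :=
    mul_left_cancel₀ h2 (by linear_combination -e10)
  have build : ∀ c : F, v 0 0 = c * w 0 0 → v 0 1 = c * w 0 1 → v 1 0 = c * w 1 0 →
      v = c • w := by
    intro c h1 h2 h3
    ext i j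
    fin_cases i <;> fin_cases j <;> simp [h1, h2, h3, hv', hw']
  by_cases ha : w 0 0 = 0
  · by_cases hb : w 0 1 = 0
    · have hc : w 1 0 ≠ 0 := fun hc => hw0 <| by
        ext i j
        fin_cases i <;> fin_cases j <;> simp [ha, hb, hc, hw']
      refine ⟨v 1 0 / w 1 0, build _ ?_ ?_ ?_⟩ <;> field_simp <;> grind
    · refine ⟨v 0 1 / w 0 1, build _ ?_ ?_ ?_⟩ <;> field_simp <;> grind
  · refine ⟨v 0 0 / w 0 0, build _ ?_ ?_ ?_⟩ <;> field_simp <;> grind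

/-- The trace-zero matrices of determinant `1` or `δ`. -/
def Axis (δ : F) : Type _ :=
  {v : Matrix (Fin 2) (Fin 2) F // v.trace = 0 ∧ (v.det = 1 ∨ v.det = δ)}

instance [Finite F] (δ : F) : Finite (Axis δ) := Subtype.finite

/-- The conjugation action. -/
instance (δ : F) : MulAction SL(2, F) (Axis δ) where
  smul g v := ⟨g.1 * v.1 * (g⁻¹).1, by
    have hg : (g⁻¹).1 * g.1 = 1 := by
      rw [← Matrix.SpecialLinearGroup.coe_mul, inv_mul_cancel, Matrix.SpecialLinearGroup.coe_one]
    rw [Matrix.trace_mul_comm, ← mul_assoc, hg, one_mul, det_mul, det_mul, g.2, (g⁻¹).2,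
      one_mul, mul_one]
    exact v.2⟩
  one_smul v := Subtype.ext <| by
    change (1 : SL(2, F)).1 * v.1 * ((1 : SL(2, F))⁻¹).1 = v.1
    simp
  mul_smul g h v := Subtype.ext <| by
    change (g * h).1 * v.1 * ((g * h)⁻¹).1 = g.1 * (h.1 * v.1 * (h⁻¹).1) * (g⁻¹).1
    rw [_root_.mul_inv_rev, Matrix.SpecialLinearGroup.coe_mul, Matrix.SpecialLinearGroup.coe_mul]
    simp only [mul_assoc]

theorem Axis.smul_eq_iff {δ : F} {g : SL(2, F)} {v : Axis δ} :
    g • v = v ↔ g.1 * v.1 = v.1 * g.1 := by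
  have h1 : (g⁻¹).1 * g.1 = 1 := by
    rw [← Matrix.SpecialLinearGroup.coe_mul, inv_mul_cancel, Matrix.SpecialLinearGroup.coe_one]
  have h2 : g.1 * (g⁻¹).1 = 1 := by
    rw [← Matrix.SpecialLinearGroup.coe_mul, mul_inv_cancel, Matrix.SpecialLinearGroup.coe_one]
  constructor
  · intro h
    replace h : g.1 * v.1 * (g⁻¹).1 = v.1 := congrArg Subtype.val h
    conv_rhs => rw [← h]
    rw [mul_assoc, h1, mul_one]
  · intro h
    apply Subtype.ext
    change g.1 * v.1 * (g⁻¹).1 = v.1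
    rw [h, mul_assoc, h2, mul_one]

theorem Axis.smul_eq_of_mem_center {δ : F} {g : SL(2, F)} (hg : g ∈ center SL(2, F))
    (v : Axis δ) : g • v = v := by
  rw [Axis.smul_eq_iff]
  rcases mem_center_iff_eq_one_or_neg_one.1 hg with rfl | rfl <;> simp

theorem Axis.commute_of_smul_eq (h2 : (2 : F) ≠ 0) {δ : F} (hδ : δ ≠ 0) {g h : SL(2, F)}
    {v : Axis δ} (hg : g • v = v) (hh : h • v = v) : Commute g h := by
  rw [Axis.smul_eq_iff] at hg hh
  have hv0 : v.1 ≠ 0 := fun h0 => by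
    rcases v.2.2 with h' | h' <;> rw [h0] at h' <;> simp at h'
    exact hδ h'.symm
  have traceless : ∀ k : SL(2, F), k.1 * v.1 = v.1 * k.1 →
      ∃ c : F, (2 : F) • k.1 = c • v.1 + k.1.trace • 1 := by
    intro k hk
    obtain ⟨c, hc⟩ := exists_eq_smul_of_commute h2 (v := (2 : F) • k.1 - k.1.trace • 1) (w := v.1)
      (by simp [trace_sub, trace_smul]; ring) v.2.1 hv0
      (by simp [sub_mul, mul_sub, hk])
    exact ⟨c, by rw [← hc]; simp⟩
  obtain ⟨a, ha⟩ := traceless g hg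
  apply Subtype.ext
  rw [Matrix.SpecialLinearGroup.coe_mul, Matrix.SpecialLinearGroup.coe_mul]
  have : (2 : F) • (g.1 * h.1) = (2 : F) • (h.1 * g.1) := by
    rw [← smul_mul_assoc, ← mul_smul_comm, ha]
    simp [add_mul, mul_add, hh]
  exact smul_right_injective _ h2 this

theorem Axis.card_fixedBy [Finite F] (h2 : (2 : F) ≠ 0) {δ : F} (hδ : ¬IsSquare δ)
    {g : SL(2, F)} (hg : (g : Matrix (Fin 2) (Fin 2) F).trace ^ 2 ≠ 4) :
    Nat.card (MulAction.fixedBy (Axis δ) g) = 2 := by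
  have hδ0 : δ ≠ 0 := fun h => hδ (h ▸ IsSquare.zero)
  set t := (g : Matrix (Fin 2) (Fin 2) F).trace with ht
  set w : Matrix (Fin 2) (Fin 2) F := (2 : F) • g.1 - t • 1 with hw
  have hwt : w.trace = 0 := by
    simp [hw, trace_sub, trace_smul, ← ht]; ring
  have hwd : w.det = 4 - t ^ 2 := by
    have := g.det_coe
    rw [det_fin_two] at this ⊢
    simp [hw, ht, trace_fin_two]
    linear_combination 4 * this
  have hd0 : w.det ≠ 0 := by rw [hwd, sub_ne_zero]; exact hg.symm
  have hcomm : ∀ v : Matrix (Fin 2) (Fin 2) F, g.1 * v = v * g.1 ↔ v * w = w * v := by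
    intro v
    simp only [hw, mul_sub, sub_mul, Matrix.mul_smul, Matrix.smul_mul, mul_one, one_mul,
      sub_left_inj]
    exact ⟨fun h => by rw [h], fun h => (smul_right_injective _ h2 h).symm⟩
  obtain ⟨c, hc⟩ : ∃ c : F, c ^ 2 * w.det = 1 ∨ c ^ 2 * w.det = δ := by
    by_cases hsq : IsSquare w.det
    · obtain ⟨d, hd⟩ := hsq
      refine ⟨d⁻¹, Or.inl ?_⟩
      have : d ≠ 0 := fun h => hd0 (by rw [hd, h, zero_mul])
      rw [hd]; field_simp
    · have : IsSquare (δ * w.det) := by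
        classical
        have := Fintype.ofFinite F
        rw [← quadraticChar_neg_one_iff_not_isSquare] at hsq hδ
        rw [← quadraticChar_one_iff_isSquare (mul_ne_zero hδ0 hd0), map_mul, hsq, hδ]
        rfl
      obtain ⟨d, hd⟩ := this
      refine ⟨d / w.det, Or.inr ?_⟩
      field_simp
      linear_combination -hd
  have hudet : (c • w).det = 1 ∨ (c • w).det = δ := by
    rw [det_smul, Fintype.card_fin]; exact hc
  have hut : (c • w).trace = 0 := by rw [trace_smul, hwt, smul_zero]
  let u : Axis δ := ⟨c • w, hut, hudet⟩
  let u' : Axis δ := ⟨-(c • w), by rw [trace_neg, hut, neg_zero], by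
    rw [det_neg, Fintype.card_fin]; simpa using hudet⟩
  have hu0 : c • w ≠ 0 := fun h0 => by
    rcases hudet with h' | h' <;> rw [h0] at h' <;> simp at h'
    exact hδ0 h'.symm
  have huu' : u ≠ u' := fun h => by
    have h1 : c • w = -(c • w) := congrArg Subtype.val h
    apply hu0
    have : (2 : F) • (c • w) = 0 := by rw [two_smul]; nth_rewrite 1 [h1]; simp
    exact (smul_eq_zero.1 this).resolve_left h2
  have hfix : MulAction.fixedBy (Axis δ) g = {u, u'} := by
    ext v
    rw [MulAction.mem_fixedBy, Axis.smul_eq_iff, hcomm]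
    constructor
    · intro h
      obtain ⟨a, ha⟩ := exists_eq_smul_of_commute h2 v.2.1 hut hu0
        (by rw [Matrix.mul_smul, Matrix.smul_mul, h])
      have hdet : v.1.det = a ^ 2 * (c • w).det := by rw [ha, det_smul, Fintype.card_fin]
      have ha2 : a ^ 2 = 1 := by
        have hv := v.2.2
        rcases hv with h' | h' <;> rcases hudet with h'' | h'' <;> rw [h', h''] at hdet
        · rw [mul_one] at hdet; exact hdet.symm
        · refine absurd ⟨a⁻¹, ?_⟩ hδ
          have : a ≠ 0 := by rintro rfl; simp at hdet
          field_simp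
          linear_combination -hdet
        · refine absurd ⟨a, ?_⟩ hδ
          linear_combination hdet
        · exact mul_right_cancel₀ hδ0 (by rw [one_mul]; exact hdet.symm)
      rcases sq_eq_one_iff.1 ha2 with h' | h'
      · left; apply Subtype.ext; rw [ha, h', one_smul]
      · right; apply Subtype.ext; rw [ha, h', neg_one_smul]
    · rintro (rfl | rfl)
      · simp [u]
      · simp [u']
  rw [hfix, Nat.card_coe_set_eq, Set.ncard_pair huu']

end SpecialLinearTwo

section Generation

open Matrix Subgroup

/-- The upper unitriangular matrix with off-diagonal entry `b`. -/
def upperUnipotent {R : Type*} [CommRing R] (b : R) : SL(2, R) := ⟨!![1, b; 0, 1], by simp⟩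

/-- The lower unitriangular matrix with off-diagonal entry `b`. -/
def lowerUnipotent {R : Type*} [CommRing R] (b : R) : SL(2, R) := ⟨!![1, 0; b, 1], by simp⟩

theorem upperUnipotent_pow {R : Type*} [CommRing R] (b : R) (n : ℕ) :
    upperUnipotent b ^ n = upperUnipotent (n * b) := by
  induction n with
  | zero => rw [pow_zero]; apply Subtype.ext; simp [upperUnipotent, one_fin_two]
  | succ n ih =>
    rw [pow_succ, ih]
    apply Subtype.ext
    rw [Matrix.SpecialLinearGroup.coe_mul]
    simp [upperUnipotent]
    ring

theorem eq_top_of_forall_upperUnipotent_mem {F : Type*} [Field F] {K : Subgroup SL(2, F)}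
    (hU : ∀ b, upperUnipotent b ∈ K) {x : SL(2, F)} (hx : x ∈ K)
    (hx0 : (x : Matrix (Fin 2) (Fin 2) F) 1 0 ≠ 0) : K = ⊤ := by
  have hL : ∀ m, lowerUnipotent m ∈ K := by
    intro m
    set a := (x : Matrix (Fin 2) (Fin 2) F) 0 0
    set c := (x : Matrix (Fin 2) (Fin 2) F) 1 0
    set d := (x : Matrix (Fin 2) (Fin 2) F) 1 1
    have hw : upperUnipotent (-a / c) * x * upperUnipotent (-d / c) ∈ K :=
      mul_mem (mul_mem (hU _) hx) (hU _)
    have hwval : ((upperUnipotent (-a / c) * x * upperUnipotent (-d / c) : SL(2, F)) :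
        Matrix (Fin 2) (Fin 2) F) = !![0, -1 / c; c, 0] := by
      have hdet := x.det_coe
      rw [det_fin_two] at hdet
      rw [Matrix.SpecialLinearGroup.coe_mul, Matrix.SpecialLinearGroup.coe_mul]
      ext i j
      fin_cases i <;> fin_cases j <;> simp [upperUnipotent, Matrix.mul_apply, vecMul,
        dotProduct, Fin.sum_univ_two] <;> (try field_simp) <;> grind
    have hmul := mul_mem (mul_mem hw (hU (-m / c ^ 2))) (inv_mem hw)
    convert hmul using 1
    apply Subtype.ext
    rw [Matrix.SpecialLinearGroup.coe_mul, Matrix.SpecialLinearGroup.coe_mul,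
      Matrix.SpecialLinearGroup.coe_inv, hwval, adjugate_fin_two]
    ext i j
    fin_cases i <;> fin_cases j <;>
      simp [upperUnipotent, lowerUnipotent, Matrix.mul_apply] <;> try field_simp
  have hmain : ∀ g : SL(2, F), (g : Matrix (Fin 2) (Fin 2) F) 1 0 ≠ 0 → g ∈ K := by
    intro g hg
    set a := (g : Matrix (Fin 2) (Fin 2) F) 0 0 with ha
    set c := (g : Matrix (Fin 2) (Fin 2) F) 1 0 with hc
    set d := (g : Matrix (Fin 2) (Fin 2) F) 1 1 with hd
    have hmem := mul_mem (mul_mem (hU ((a - 1) / c)) (hL c)) (hU ((d - 1) / c))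
    convert hmem using 1
    apply Subtype.ext
    have hdet := g.det_coe
    rw [det_fin_two] at hdet
    rw [Matrix.SpecialLinearGroup.coe_mul, Matrix.SpecialLinearGroup.coe_mul]
    ext i j
    fin_cases i <;> fin_cases j <;>
      simp [upperUnipotent, lowerUnipotent, Matrix.mul_apply, ← ha, ← hc, ← hd] <;>
      field_simp <;> grind
  rw [eq_top_iff]
  intro g _
  by_cases hg : (g : Matrix (Fin 2) (Fin 2) F) 1 0 = 0
  · have h1 : lowerUnipotent 1 * g ∈ K := hmain _ <| by
      have hdet := g.det_coe
      rw [det_fin_two, hg] at hdet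
      rw [Matrix.SpecialLinearGroup.coe_mul]
      simp [lowerUnipotent, Matrix.mul_apply, hg]
      rintro h
      simp [h] at hdet
    exact (mul_mem_cancel_left (hL 1)).1 h1
  · exact hmain g hg

variable {p : ℕ} [Fact p.Prime]

/-- A subgroup of `SL₂(p)` containing a nontrivial unipotent and an element without eigenvalues
in the prime field is everything. -/
theorem eq_top_of_unipotent_mem {K : Subgroup SL(2, ZMod p)} {u x : SL(2, ZMod p)} (hu : u ∈ K)
    (hut : (u : Matrix (Fin 2) (Fin 2) (ZMod p)).trace = 2) (hu1 : u ≠ 1) (hx : x ∈ K)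
    (hns : ∀ r : ZMod p, r ^ 2 ≠ (x : Matrix (Fin 2) (Fin 2) (ZMod p)).trace ^ 2 - 4) : K = ⊤ := by
  obtain ⟨g, b, hgb⟩ : ∃ (g : SL(2, ZMod p)) (b : ZMod p), g⁻¹ * u * g = upperUnipotent b := by
    have hdet := u.det_coe
    rw [det_fin_two] at hdet
    rw [trace_fin_two] at hut
    by_cases hc : (u : Matrix (Fin 2) (Fin 2) (ZMod p)) 1 0 = 0
    · refine ⟨1, u.1 0 1, ?_⟩
      have ha : (u : Matrix (Fin 2) (Fin 2) (ZMod p)) 0 0 = 1 := by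
        rw [← sub_eq_zero]
        refine pow_eq_zero_iff two_ne_zero |>.1 ?_
        grind
      have hd : (u : Matrix (Fin 2) (Fin 2) (ZMod p)) 1 1 = 1 := by grind
      apply Subtype.ext
      ext i j
      fin_cases i <;> fin_cases j <;> simp [upperUnipotent, ha, hc, hd]
    · set a := (u : Matrix (Fin 2) (Fin 2) (ZMod p)) 0 0
      set c := (u : Matrix (Fin 2) (Fin 2) (ZMod p)) 1 0
      obtain ⟨g, hg⟩ : ∃ g : SL(2, ZMod p),
          (g : Matrix (Fin 2) (Fin 2) (ZMod p)) = !![a - 1, -1 / c; c, 0] :=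
        ⟨⟨!![a - 1, -1 / c; c, 0], by simp [det_fin_two]; field_simp⟩, rfl⟩
      refine ⟨g, -1 / c, ?_⟩
      rw [mul_assoc, inv_mul_eq_iff_eq_mul]
      apply Subtype.ext
      rw [Matrix.SpecialLinearGroup.coe_mul, Matrix.SpecialLinearGroup.coe_mul, hg]
      ext i j
      fin_cases i <;> fin_cases j <;> simp [upperUnipotent, Matrix.mul_apply,
        Fin.sum_univ_two] <;> (try field_simp) <;> grind
  have hb : b ≠ 0 := by
    rintro rfl
    have h1 : upperUnipotent (0 : ZMod p) = 1 := by
      apply Subtype.ext; simp [upperUnipotent, one_fin_two]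
    rw [h1, mul_assoc, inv_mul_eq_one] at hgb
    exact hu1 (by simpa using hgb)
  have hmem : ∀ k : SL(2, ZMod p), k ∈ K → g⁻¹ * k * g ∈ K.comap (MulAut.conj g).toMonoidHom := by
    intro k hk
    simpa [mul_assoc] using hk
  have htop : K.comap (MulAut.conj g).toMonoidHom = ⊤ := by
    refine eq_top_of_forall_upperUnipotent_mem (x := g⁻¹ * x * g) (fun β => ?_) (hmem x hx) ?_
    · have := pow_mem (hmem u hu) (β / b).val
      rw [hgb, upperUnipotent_pow, ZMod.natCast_zmod_val, div_mul_cancel₀ _ hb] at this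
      exact this
    · intro h0
      have htr : ((g⁻¹ * x * g : SL(2, ZMod p)) : Matrix (Fin 2) (Fin 2) (ZMod p)).trace =
          (x : Matrix (Fin 2) (Fin 2) (ZMod p)).trace := by
        rw [Matrix.SpecialLinearGroup.coe_mul, Matrix.trace_mul_comm,
          ← Matrix.SpecialLinearGroup.coe_mul]
        simp
      have hdet := (g⁻¹ * x * g).det_coe
      rw [det_fin_two, h0] at hdet
      rw [trace_fin_two] at htr
      apply hns (((g⁻¹ * x * g : SL(2, ZMod p)) : Matrix (Fin 2) (Fin 2) (ZMod p)) 0 0 -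
        ((g⁻¹ * x * g : SL(2, ZMod p)) : Matrix (Fin 2) (Fin 2) (ZMod p)) 1 1)
      rw [← htr]
      linear_combination -4 * hdet
  rw [eq_top_iff]
  intro k _
  have : g⁻¹ * k * g ∈ K.comap (MulAut.conj g).toMonoidHom := htop ▸ mem_top _
  simpa [mul_assoc] using this

/-- An element of `SL₂(p)` whose `(p + 1)`-st power is central but whose square is not has no
eigenvalues in the prime field. -/
theorem sq_ne_trace_sq_sub_four (hp2 : (2 : ZMod p) ≠ 0) {x : SL(2, ZMod p)}
    (hx : x ^ (p + 1) ∈ center SL(2, ZMod p)) (hx2 : x ^ 2 ∉ center SL(2, ZMod p)) (r : ZMod p) :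
    r ^ 2 ≠ (x : Matrix (Fin 2) (Fin 2) (ZMod p)).trace ^ 2 - 4 := by
  intro hr
  obtain ⟨ε, -, hε⟩ := Matrix.SpecialLinearGroup.mem_center_iff.1 hx
  have hε' : (x : Matrix (Fin 2) (Fin 2) (ZMod p)) ^ (p + 1) = ε • 1 := by
    rw [← Matrix.SpecialLinearGroup.coe_pow, ← hε, smul_one_eq_diagonal]; rfl
  set X := (x : Matrix (Fin 2) (Fin 2) (ZMod p)) with hX
  set t := X.trace with ht
  set l := (t + r) / 2 with hl
  set m := (t - r) / 2 with hm
  have hlm : l + m = t := by rw [hl, hm]; field_simp; ring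
  have hlm1 : l * m = 1 := by
    have h4 : (4 : ZMod p) ≠ 0 := by
      rw [show (4 : ZMod p) = 2 * 2 by norm_num]; exact mul_ne_zero hp2 hp2
    apply mul_left_cancel₀ h4
    rw [hl, hm]
    field_simp
    linear_combination -hr
  have hl0 : l ≠ 0 := left_ne_zero_of_mul_eq_one hlm1
  have hsq : X ^ 2 = t • X - 1 := coe_sq_eq_trace_smul_sub_one x
  set N := X - l • 1 with hN
  have hNsq : N * N = (m - l) • N := by
    rw [hN, sub_mul, mul_sub, mul_sub, ← sq, hsq, ← hlm]
    have : (1 : Matrix (Fin 2) (Fin 2) (ZMod p)) = (l * m) • 1 := by rw [hlm1, one_smul]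
    nth_rewrite 1 [this]
    simp only [Matrix.mul_smul, Matrix.smul_mul, mul_one, one_mul]
    module
  have hNpow : ∀ n : ℕ, N ^ (n + 1) = (m - l) ^ n • N := by
    intro n
    induction n with
    | zero => simp
    | succ n ih => rw [pow_succ, ih, smul_mul_assoc, hNsq, smul_smul, pow_succ]
  have hNp : N ^ p = X ^ p - l • 1 := by
    rw [hN, sub_pow_char_of_commute p (by simp [Commute, SemiconjBy]), smul_pow, one_pow,
      ZMod.pow_card]
  have hp1 : p = (p - 1) + 1 := (Nat.succ_pred_prime Fact.out).symm
  have key : ε • (1 : Matrix (Fin 2) (Fin 2) (ZMod p)) - l • X = (m - l) ^ (p - 1) • (N * X) := by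
    rw [← hε', pow_succ, ← smul_mul_assoc, ← hNpow, ← hp1, hNp, sub_mul]
    simp
  by_cases heq : m - l = 0
  · rw [heq, zero_pow (Nat.sub_ne_zero_of_lt (Fact.out : p.Prime).one_lt), zero_smul,
      sub_eq_zero] at key
    exact hx2 (pow_mem (mem_center_of_smul_eq hl0 key.symm) 2)
  · rw [ZMod.pow_card_sub_one_eq_one heq, one_smul, hN, sub_mul, ← sq, smul_mul_assoc,
      one_mul, sub_left_inj] at key
    refine hx2 (mem_center_of_smul_eq (b := ε) one_ne_zero ?_)
    rw [one_smul, Matrix.SpecialLinearGroup.coe_pow, ← hX, ← key]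

end Generation

section Conic

open Matrix

open Classical in
/-- The matrices `y` in `SL₂(F)` of trace zero with `tr (x * y)` prescribed form a conic, which
is anisotropic at infinity when `x` has no eigenvalues in `F`. -/
theorem card_trace_eq_zero_trace_mul_eq_le {F : Type*} [Field F] [Fintype F] {x : SL(2, F)}
    (hns : ∀ r : F, r ^ 2 ≠ (x : Matrix (Fin 2) (Fin 2) F).trace ^ 2 - 4) (s : F) :
    (Finset.univ.filter fun y : SL(2, F) => (y : Matrix (Fin 2) (Fin 2) F).trace = 0 ∧
      ((x * y : SL(2, F)) : Matrix (Fin 2) (Fin 2) F).trace = s).card ≤ Fintype.card F + 2 := by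
  set S := Finset.univ.filter fun y : SL(2, F) => (y : Matrix (Fin 2) (Fin 2) F).trace = 0 ∧
      ((x * y : SL(2, F)) : Matrix (Fin 2) (Fin 2) F).trace = s with hS
  rcases S.eq_empty_or_nonempty with h | ⟨z, hz⟩
  · rw [h, Finset.card_empty]; omega
  obtain ⟨q, r, u, v, hx, hx'⟩ : ∃ q r u v : F,
      (x : Matrix (Fin 2) (Fin 2) F) = !![q, r; u, v] ∧ q * v - r * u = 1 :=
    ⟨_, _, _, _, eta_fin_two _, by rw [← det_fin_two]; exact x.det_coe⟩
  rw [hx, trace_fin_two] at hns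
  simp only [of_apply, cons_val', cons_val_zero, cons_val_one, cons_val_fin_one] at hns
  have hq : ∀ m : F, m ^ 2 * u - (q - v) * m - r ≠ 0 := by
    intro m hm
    apply hns (2 * u * m - (q - v))
    linear_combination 4 * u * hm - 4 * hx'
  have hu : u ≠ 0 := by
    rintro rfl
    apply hns (q - v)
    linear_combination -4 * hx'
  have hmem : ∀ y ∈ S, ∃ a b c : F, (y : Matrix (Fin 2) (Fin 2) F) = !![a, b; c, -a] ∧
      -a ^ 2 - b * c = 1 ∧ (q - v) * a + r * c + u * b = s := by
    intro y hy
    rw [hS, Finset.mem_filter, Matrix.SpecialLinearGroup.coe_mul, hx] at hy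
    obtain ⟨-, ht, hs⟩ := hy
    have hdet := y.det_coe
    rw [trace_fin_two] at ht hs
    rw [det_fin_two] at hdet
    have hd : (y : Matrix (Fin 2) (Fin 2) F) 1 1 = -y.1 0 0 := by linear_combination ht
    simp [Matrix.mul_apply] at hs
    refine ⟨y.1 0 0, y.1 0 1, y.1 1 0, ?_, ?_, ?_⟩
    · rw [← hd]; exact eta_fin_two _
    · rw [hd] at hdet; linear_combination hdet
    · rw [hd] at hs; linear_combination hs
  obtain ⟨a₀, b₀, c₀, hz0, hzd, hzs⟩ := hmem z hz
  let f : SL(2, F) → Option F := fun y =>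
    if y.1 1 0 = z.1 1 0 then none else some ((y.1 0 0 - z.1 0 0) / (y.1 1 0 - z.1 1 0))
  have hinj : Set.InjOn f (S.erase z) := by
    intro y hy y' hy' hf
    obtain ⟨hyz, hy⟩ := Finset.mem_erase.1 hy
    obtain ⟨hyz', hy'⟩ := Finset.mem_erase.1 hy'
    obtain ⟨a, b, c, hy0, hyd, hys⟩ := hmem y hy
    obtain ⟨a', b', c', hy0', hyd', hys'⟩ := hmem y' hy'
    have hb : ∀ {a b c a₁ b₁ c₁ : F}, (q - v) * a + r * c + u * b = s →
        (q - v) * a₁ + r * c₁ + u * b₁ = s → a = a₁ → c = c₁ → b = b₁ := by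
      intro a b c a₁ b₁ c₁ h h₁ ha hc
      apply mul_left_cancel₀ hu
      rw [ha, hc] at h
      linear_combination h - h₁
    simp only [f] at hf
    change (if (y : Matrix (Fin 2) (Fin 2) F) 1 0 = (z : Matrix (Fin 2) (Fin 2) F) 1 0 then none
      else some (((y : Matrix (Fin 2) (Fin 2) F) 0 0 - (z : Matrix (Fin 2) (Fin 2) F) 0 0) /
        ((y : Matrix (Fin 2) (Fin 2) F) 1 0 - (z : Matrix (Fin 2) (Fin 2) F) 1 0))) =
      (if (y' : Matrix (Fin 2) (Fin 2) F) 1 0 = (z : Matrix (Fin 2) (Fin 2) F) 1 0 then none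
      else some (((y' : Matrix (Fin 2) (Fin 2) F) 0 0 - (z : Matrix (Fin 2) (Fin 2) F) 0 0) /
        ((y' : Matrix (Fin 2) (Fin 2) F) 1 0 - (z : Matrix (Fin 2) (Fin 2) F) 1 0))) at hf
    rw [hy0, hy0', hz0] at hf
    simp only [of_apply, cons_val', cons_val_zero, cons_val_one, cons_val_fin_one] at hf
    suffices h : a = a' ∧ c = c' by
      apply Subtype.ext
      rw [hy0, hy0', h.1, h.2, hb hys hys' h.1 h.2]
    have hvert : ∀ {y : SL(2, F)} {a b c : F}, y ≠ z →
        (y : Matrix (Fin 2) (Fin 2) F) = !![a, b; c, -a] → -a ^ 2 - b * c = 1 →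
        (q - v) * a + r * c + u * b = s → c = c₀ → u * (a + a₀) = (q - v) * c₀ := by
      intro y a b c hne hy0 hyd hys hc
      have ha : a - a₀ ≠ 0 := fun h => hne <| Subtype.ext <| by
        rw [hy0, hz0, hc, sub_eq_zero.1 h, hb hys hzs (sub_eq_zero.1 h) hc]
      apply mul_left_cancel₀ ha
      rw [hc] at hyd hys
      linear_combination u * hzd - u * hyd - c₀ * hys + c₀ * hzs
    have hslope : ∀ {a b c m : F}, -a ^ 2 - b * c = 1 →
        (q - v) * a + r * c + u * b = s → c - c₀ ≠ 0 → a - a₀ = m * (c - c₀) →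
        (c - c₀) * (m ^ 2 * u - (q - v) * m - r) =
          -2 * a₀ * u * m - b₀ * u + ((q - v) * m + r) * c₀ := by
      intro a b c m hyd hys hc ha
      apply mul_left_cancel₀ hc
      obtain rfl : a = a₀ + m * (c - c₀) := by linear_combination ha
      linear_combination u * hzd - u * hyd - c * hys + c * hzs
    split_ifs at hf with h1 h2 h2
    · refine ⟨?_, h1.trans h2.symm⟩
      have e := hvert hyz hy0 hyd hys h1
      have e' := hvert hyz' hy0' hyd' hys' h2
      apply mul_left_cancel₀ hu
      linear_combination e - e'
    · have n1 : c - c₀ ≠ 0 := sub_ne_zero.2 h1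
      have n2 : c' - c₀ ≠ 0 := sub_ne_zero.2 h2
      rw [Option.some_inj] at hf
      obtain ⟨m, hm⟩ : ∃ m, m = (a - a₀) / (c - c₀) := ⟨_, rfl⟩
      rw [← hm] at hf
      have e1 : a - a₀ = m * (c - c₀) := by rw [hm]; field_simp
      have e2 : a' - a₀ = m * (c' - c₀) := by rw [hf]; field_simp
      have k1 := hslope hyd hys n1 e1
      have k2 := hslope hyd' hys' n2 e2
      have hc : c = c' := by
        have := mul_right_cancel₀ (hq m) (k1.trans k2.symm)
        linear_combination this
      refine ⟨?_, hc⟩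
      rw [hc] at e1
      linear_combination e1 - e2
  have hcard : (S.erase z).card ≤ Fintype.card (Option F) := by
    rw [← Finset.card_image_of_injOn hinj]
    exact Finset.card_le_univ _
  rw [Finset.card_erase_of_mem hz, Fintype.card_option] at hcard
  omega

end Conic

section Main

open Matrix Subgroup

variable {p : ℕ} [Fact p.Prime]

/-- If `x` has no eigenvalues in the prime field, an involution `y` generating together with `x`
a proper subgroup of `PSL₂(p)` satisfies a polynomial condition on the trace of `x * y`. -/
theorem trace_mul_root_of_mem_proper (h2 : (2 : ZMod p) ≠ 0) {K : Subgroup SL(2, ZMod p)}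
    (hK : K ≠ ⊤) (hcK : center SL(2, ZMod p) ≤ K) {x y : SL(2, ZMod p)} (hx : x ∈ K) (hy : y ∈ K)
    (hxp : x ^ (p + 1) ∈ center SL(2, ZMod p)) (hx2 : x ^ 2 ∉ center SL(2, ZMod p))
    (hyt : (y : Matrix (Fin 2) (Fin 2) (ZMod p)).trace = 0) :
    let t := (x : Matrix (Fin 2) (Fin 2) (ZMod p)).trace
    let s := ((x * y : SL(2, ZMod p)) : Matrix (Fin 2) (Fin 2) (ZMod p)).trace
    s * (s ^ 2 - 1) * (s ^ 2 - 2) * (s ^ 4 - 3 * s ^ 2 + 1) * (s ^ 2 - (4 - t ^ 2)) = 0 := by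
  classical
  intro t s
  have hns := sq_ne_trace_sq_sub_four h2 hxp hx2
  have hneg : (-1 : SL(2, ZMod p)) ∈ center SL(2, ZMod p) :=
    mem_center_iff_eq_one_or_neg_one.2 (Or.inr rfl)
  have hss : ∀ g ∈ K, g ∉ center SL(2, ZMod p) →
      (g : Matrix (Fin 2) (Fin 2) (ZMod p)).trace ^ 2 ≠ 4 := by
    intro g hg hgc h4
    have : (g : Matrix (Fin 2) (Fin 2) (ZMod p)).trace ^ 2 = 2 ^ 2 := by rw [h4]; norm_num
    rcases sq_eq_sq_iff_eq_or_eq_neg.1 this with h | h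
    · exact hK (eq_top_of_unipotent_mem hg h (fun h1 => hgc (h1 ▸ one_mem _)) hx hns)
    · refine hK (eq_top_of_unipotent_mem (u := -1 * g) (mul_mem (hcK hneg) hg) ?_ ?_ hx hns)
      · rw [neg_one_mul, Matrix.SpecialLinearGroup.coe_neg, trace_neg, h, neg_neg]
      · intro h1
        rw [neg_one_mul, neg_eq_iff_eq_neg] at h1
        exact hgc (h1 ▸ hneg)
  obtain ⟨δ, hδ⟩ : ∃ δ : ZMod p, ¬IsSquare δ :=
    FiniteField.exists_nonsquare (by rw [ZMod.ringChar_zmod_n]; rintro rfl; exact h2 rfl)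
  have hδ0 : δ ≠ 0 := fun h => hδ (h ▸ IsSquare.zero)
  have := Fintype.ofFinite (Axis δ)
  let Z : Subgroup K := (center SL(2, ZMod p)).subgroupOf K
  have hZ2 : Nat.card Z = 2 := by
    rw [Nat.card_congr (subgroupOfEquivOfLe hcK).toEquiv, card_center_eq_two h2]
  have hZ : ∀ g ∈ Z, ∀ v : Axis δ, g • v = v := fun g hg v =>
    Axis.smul_eq_of_mem_center (mem_subgroupOf.1 hg) v
  have hfix : ∀ g ∉ Z, Nat.card (MulAction.fixedBy (Axis δ) g) = 2 := fun g hg =>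
    Axis.card_fixedBy h2 hδ (hss g g.2 fun h => hg (mem_subgroupOf.2 h))
  have hyc : y ^ 2 = -1 := sq_eq_neg_one_of_trace_eq_zero hyt
  have hz : x * y ∉ center SL(2, ZMod p) := by
    intro h
    have hcomm : Commute x y := by
      have h1 := (mem_center_iff.1 h y)
      rw [← mul_assoc] at h1
      exact (mul_right_cancel h1).symm
    apply hx2
    have h1 := pow_mem h 2
    rw [hcomm.mul_pow, hyc] at h1
    exact (mul_mem_cancel_right hneg).1 h1
  let zK : K := ⟨x * y, mul_mem hx hy⟩
  obtain ⟨v, hv⟩ : ∃ v : Axis δ, zK • v = v := by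
    have hpos : 0 < Nat.card (MulAction.fixedBy (Axis δ) zK) := by
      rw [hfix zK fun h => hz (mem_subgroupOf.1 h)]; norm_num
    obtain ⟨⟨⟨v, h⟩⟩, _⟩ := Nat.card_pos_iff.1 hpos
    exact ⟨v, h⟩
  by_cases hE : 12 ≤ Nat.card (MulAction.stabilizer K v)
  · have hxv : (⟨x, hx⟩ : K) • v = v := by
      refine smul_eq_of_twelve_le_card_stabilizer hZ2 hZ hfix hE fun h => hx2 ?_
      refine mem_center_of_sq_eq_one h2 ?_
      rw [← pow_mul]
      exact congrArg Subtype.val h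
    have hcomm : Commute x (x * y) := Axis.commute_of_smul_eq h2 hδ0 hxv hv
    have hxy : Commute x y := mul_left_cancel (a := x) (by rw [hcomm.eq, mul_assoc])
    have : s ^ 2 = 4 - t ^ 2 := trace_mul_sq_of_commute hxy hyt
    rw [this, sub_self, mul_zero]
  · have heven : 2 ∣ Nat.card (MulAction.stabilizer K v) :=
      hZ2.symm.dvd.trans
        (card_dvd_of_le (H := Z) (K := MulAction.stabilizer K v) fun g hg => hZ g hg v)
    have hpow : (x * y) ^ Nat.card (MulAction.stabilizer K v) = 1 := by
      have h1 := pow_card_eq_one' (x := (⟨zK, hv⟩ : MulAction.stabilizer K v))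
      exact congrArg (fun g : MulAction.stabilizer K v => (g : K).1) h1
    rw [trace_root_of_pow_eq_one h2 hz (even_iff_two_dvd.2 heven) Nat.card_pos (not_le.1 hE) hpow,
      zero_mul]

open Classical Polynomial in
/-- The elements of order two generating together with a fixed non-split semisimple element
of order at least three a proper subgroup of `PSL₂(p)`. -/
theorem two_mul_ncard_involutions_le (h2 : (2 : ZMod p) ≠ 0) {x : PSL(2, ZMod p)}
    (hxp : x ^ (p + 1) = 1) (hx2 : x ^ 2 ≠ 1) {B : Set PSL(2, ZMod p)}
    (hB : ∀ y ∈ B, orderOf y = 2 ∧ Subgroup.closure {x, y} ≠ ⊤) :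
    2 * B.ncard ≤ 11 * (p + 2) := by
  obtain ⟨x, rfl⟩ := QuotientGroup.mk_surjective x
  rw [← QuotientGroup.mk_pow, QuotientGroup.eq_one_iff] at hxp
  rw [← QuotientGroup.mk_pow, Ne, QuotientGroup.eq_one_iff] at hx2
  set t := (x : Matrix (Fin 2) (Fin 2) (ZMod p)).trace with ht
  let P : (ZMod p)[X] := X * (X ^ 2 - 1) * (X ^ 2 - 2) * (X ^ 4 - 3 * X ^ 2 + 1) *
    (X ^ 2 - C (4 - t ^ 2))
  have hP : P.Monic := by simp only [P]; monicity!
  have hPdeg : P.natDegree ≤ 11 := by simp only [P]; compute_degree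
  let S : ZMod p → Finset SL(2, ZMod p) := fun s => Finset.univ.filter fun y =>
    (y : Matrix (Fin 2) (Fin 2) (ZMod p)).trace = 0 ∧
      ((x * y : SL(2, ZMod p)) : Matrix (Fin 2) (Fin 2) (ZMod p)).trace = s
  have hcover : (QuotientGroup.mk ⁻¹' B : Set SL(2, ZMod p)) ⊆ P.roots.toFinset.biUnion S := by
    intro y hy
    obtain ⟨hord, hgen⟩ := hB _ hy
    have hy2 : y ^ 2 ∈ center SL(2, ZMod p) := by
      rw [← QuotientGroup.eq_one_iff, QuotientGroup.mk_pow]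
      exact orderOf_dvd_iff_pow_eq_one.1 hord.dvd
    have hyc : y ∉ center SL(2, ZMod p) := fun h => by
      rw [← QuotientGroup.eq_one_iff] at h
      rw [h, orderOf_one] at hord
      norm_num at hord
    have hyt := trace_eq_zero_of_sq_mem_center hy2 hyc
    have hmem : ∀ g : SL(2, ZMod p),
        (g : PSL(2, ZMod p)) ∈ ({(x : PSL(2, ZMod p)), (y : PSL(2, ZMod p))} : Set _) →
        g ∈ (Subgroup.closure {(x : PSL(2, ZMod p)), (y : PSL(2, ZMod p))}).comap
          (QuotientGroup.mk' (center SL(2, ZMod p))) := fun g hg => subset_closure hg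
    have key := trace_mul_root_of_mem_proper h2
      (K := (Subgroup.closure {(x : PSL(2, ZMod p)), (y : PSL(2, ZMod p))}).comap
          (QuotientGroup.mk' (center SL(2, ZMod p))))
      (fun h => hgen <| comap_injective (QuotientGroup.mk'_surjective _)
        (h.trans (comap_top _).symm))
      (QuotientGroup.le_comap_mk' _ _)
      (hmem x (Or.inl rfl)) (hmem y (Or.inr rfl)) hxp hx2 hyt
    rw [Finset.mem_coe, Finset.mem_biUnion]
    refine ⟨_, ?_, Finset.mem_filter.2 ⟨Finset.mem_univ _, hyt, rfl⟩⟩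
    rw [Multiset.mem_toFinset, mem_roots hP.ne_zero, IsRoot.def]
    simpa [P] using key
  have hcard : (QuotientGroup.mk ⁻¹' B : Set SL(2, ZMod p)).ncard = 2 * B.ncard := by
    rw [← Nat.card_coe_set_eq, QuotientGroup.card_preimage_mk, card_center_eq_two h2,
      Nat.card_coe_set_eq]
  rw [← hcard]
  calc (QuotientGroup.mk ⁻¹' B : Set SL(2, ZMod p)).ncard
      ≤ (P.roots.toFinset.biUnion S).card := by
        rw [← Set.ncard_coe_finset]
        exact Set.ncard_le_ncard hcover (Finset.finite_toSet _)
    _ ≤ P.roots.toFinset.card * (p + 2) := by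
        refine Finset.card_biUnion_le_card_mul _ _ _ fun s _ => ?_
        have := card_trace_eq_zero_trace_mul_eq_le (sq_ne_trace_sq_sub_four h2 hxp hx2) s
        rw [ZMod.card] at this
        convert this
    _ ≤ 11 * (p + 2) := by
        gcongr
        exact (Multiset.toFinset_card_le _).trans ((card_roots' _).trans hPdeg)

end Main

theorem coclique_bound_main1b (p : ℕ) (hp : p.Prime) (hp2 : 2 < p)
    (A : Set PSL(2, ZMod p)) (hA : IsMaximalCoclique A)
    (hnotmax : ∀ M : Subgroup PSL(2, ZMod p), IsCoatom M → A ≠ (M : Set PSL(2, ZMod p)))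
    (x : PSL(2, ZMod p)) (hxA : x ∈ A) (hx2 : 2 < orderOf x)
    (hinv : ∀ y ∈ A, y ∉ Subgroup.zpowers x → orderOf y = 2)
    (hxdvd : orderOf x ∣ p + 1)
    (hA5S4 : HasMaximalSubgroupIsoTo PSL(2, ZMod p) (alternatingGroup (Fin 5)) ∨
      HasMaximalSubgroupIsoTo PSL(2, ZMod p) (Equiv.Perm (Fin 4))) :
    2 * A.ncard ≤ 17 * (p + 1) + 8 := by
  have : Fact p.Prime := ⟨hp⟩
  have h2 : (2 : ZMod p) ≠ 0 := by
    intro h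
    have := (ZMod.natCast_eq_zero_iff 2 p).1 (by exact_mod_cast h)
    exact absurd (Nat.le_of_dvd two_pos this) (not_le.2 hp2)
  have hB := two_mul_ncard_involutions_le h2 (orderOf_dvd_iff_pow_eq_one.1 hxdvd)
    (pow_ne_one_of_lt_orderOf two_ne_zero hx2) (B := A \ (Subgroup.zpowers x : Set PSL(2, ZMod p)))
    fun y hy => ⟨hinv y hy.1 hy.2, hA.1 x hxA y hy.1⟩
  have hZ : (Subgroup.zpowers x : Set PSL(2, ZMod p)).ncard ≤ p + 1 := by
    rw [← Nat.card_coe_set_eq]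
    exact (Nat.card_zpowers x).trans_le (Nat.le_of_dvd p.succ_pos hxdvd)
  have hle := Set.ncard_le_ncard_sdiff_add_ncard A (Subgroup.zpowers x : Set PSL(2, ZMod p))
  omega
end
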